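/- Let p_{Y1,Y2|X} be a discrete memoryless broadcast channel with binary input whose marginal channel p_{Y1|X} is a binary symmetric channel with crossover probability p ∈ [0,1/2] and whose marginal channel p_{Y2|X} is a binary erasure channel with erasure probability ε ∈ [0,1]. Then: (i) if ε ∈ [0, H_b(p)], 𝒞₁(p_{Y1,Y2|X}) = {(R1,R2) ∈ ℝ²₊ : R1 ≤ 1 − H_b(p) and R1+R2 ≤ 1−ε}; (ii) if ε ∈ (H_b(p), 1], 𝒞₁(p_{Y1,Y2|X}) = 𝒞(p_{Y1,Y2|X}). -/

import Mathlib

open scoped BigOperators Classical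
open Finset

noncomputable section

/-- `p` is a probability mass function on the finite type `α`. -/
def IsPMF {α : Type} [Fintype α] (p : α → ℝ) : Prop :=
  (∀ a, 0 ≤ p a) ∧ ∑ a, p a = 1

/-- Shannon entropy (base 2) of a pmf on a finite type. -/
def Hent {α : Type} [Fintype α] (p : α → ℝ) : ℝ :=
  -∑ a, p a * Real.logb 2 (p a)

/-- Mutual information `I(A;B)` of a joint pmf on `α × β` (base-2 logarithms). -/
def MI {α β : Type} [Fintype α] [Fintype β] (p : α × β → ℝ) : ℝ :=
  Hent (fun a => ∑ b, p (a, b)) + Hent (fun b => ∑ a, p (a, b)) - Hent p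

/-- Conditional mutual information `I(A;B|C)` of a joint pmf on `α × β × γ`. -/
def CMI {α β γ : Type} [Fintype α] [Fintype β] [Fintype γ] (p : α × β × γ → ℝ) : ℝ :=
  Hent (fun ac : α × γ => ∑ b, p (ac.1, b, ac.2))
    + Hent (fun bc : β × γ => ∑ a, p (a, bc.1, bc.2))
    - Hent p
    - Hent (fun c : γ => ∑ a, ∑ b, p (a, b, c))

/-- A channel: every input letter gives a pmf on outputs. -/
def IsChannel {X Z : Type} [Fintype Z] (W : X → Z → ℝ) : Prop :=
  ∀ x, IsPMF (W x)

/-- Marginal channel to receiver 1 of a broadcast channel. -/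
def margW1 {X Y1 Y2 : Type} [Fintype Y2] (W : X → Y1 × Y2 → ℝ) : X → Y1 → ℝ :=
  fun x y1 => ∑ y2, W x (y1, y2)

/-- Marginal channel to receiver 2 of a broadcast channel. -/
def margW2 {X Y1 Y2 : Type} [Fintype Y1] (W : X → Y1 × Y2 → ℝ) : X → Y2 → ℝ :=
  fun x y2 => ∑ y1, W x (y1, y2)

/-- Memoryless `n`-fold extension of a broadcast channel. -/
def nFold {X Y1 Y2 : Type} (W : X → Y1 × Y2 → ℝ) (n : ℕ)
    (x : Fin n → X) (y : (Fin n → Y1) × (Fin n → Y2)) : ℝ :=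
  ∏ t, W (x t) (y.1 t, y.2 t)

section Channel

variable {X Y1 Y2 : Type} [Fintype Y1] [Fintype Y2]

/-- Average error probability; message `M2` known at receiver 1. -/
def errP1 (W : X → Y1 × Y2 → ℝ) (n k1 k2 : ℕ) (f : Fin k1 × Fin k2 → Fin n → X)
    (g1 : (Fin n → Y1) × Fin k2 → Fin k1) (g2 : (Fin n → Y2) → Fin k2) : ℝ :=
  (1 : ℝ) / ((k1 : ℝ) * (k2 : ℝ)) *
    ∑ m : Fin k1 × Fin k2, ∑ y : (Fin n → Y1) × (Fin n → Y2),
      nFold W n (f m) y * (if g1 (y.1, m.2) = m.1 ∧ g2 y.2 = m.2 then 0 else 1)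

/-- Average error probability; message `M1` known at receiver 2. -/
def errP2 (W : X → Y1 × Y2 → ℝ) (n k1 k2 : ℕ) (f : Fin k1 × Fin k2 → Fin n → X)
    (g1 : (Fin n → Y1) → Fin k1) (g2 : (Fin n → Y2) × Fin k1 → Fin k2) : ℝ :=
  (1 : ℝ) / ((k1 : ℝ) * (k2 : ℝ)) *
    ∑ m : Fin k1 × Fin k2, ∑ y : (Fin n → Y1) × (Fin n → Y2),
      nFold W n (f m) y * (if g1 y.1 = m.1 ∧ g2 (y.2, m.1) = m.2 then 0 else 1)

/-- Average error probability; no receiver side information. -/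
def errP0 (W : X → Y1 × Y2 → ℝ) (n k1 k2 : ℕ) (f : Fin k1 × Fin k2 → Fin n → X)
    (g1 : (Fin n → Y1) → Fin k1) (g2 : (Fin n → Y2) → Fin k2) : ℝ :=
  (1 : ℝ) / ((k1 : ℝ) * (k2 : ℝ)) *
    ∑ m : Fin k1 × Fin k2, ∑ y : (Fin n → Y1) × (Fin n → Y2),
      nFold W n (f m) y * (if g1 y.1 = m.1 ∧ g2 y.2 = m.2 then 0 else 1)

/-- Achievability of a rate pair with `M2` available at receiver 1. -/
def Ach1 (W : X → Y1 × Y2 → ℝ) (R : ℝ × ℝ) : Prop :=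
  0 ≤ R.1 ∧ 0 ≤ R.2 ∧ ∀ ε : ℝ, 0 < ε →
    ∃ (n k1 k2 : ℕ), 0 < n ∧ 0 < k1 ∧ 0 < k2 ∧
      ∃ (f : Fin k1 × Fin k2 → Fin n → X) (g1 : (Fin n → Y1) × Fin k2 → Fin k1)
        (g2 : (Fin n → Y2) → Fin k2),
        R.1 ≤ Real.logb 2 (k1 : ℝ) / (n : ℝ) ∧ R.2 ≤ Real.logb 2 (k2 : ℝ) / (n : ℝ) ∧
        errP1 W n k1 k2 f g1 g2 ≤ ε

/-- Achievability of a rate pair with `M1` available at receiver 2. -/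
def Ach2 (W : X → Y1 × Y2 → ℝ) (R : ℝ × ℝ) : Prop :=
  0 ≤ R.1 ∧ 0 ≤ R.2 ∧ ∀ ε : ℝ, 0 < ε →
    ∃ (n k1 k2 : ℕ), 0 < n ∧ 0 < k1 ∧ 0 < k2 ∧
      ∃ (f : Fin k1 × Fin k2 → Fin n → X) (g1 : (Fin n → Y1) → Fin k1)
        (g2 : (Fin n → Y2) × Fin k1 → Fin k2),
        R.1 ≤ Real.logb 2 (k1 : ℝ) / (n : ℝ) ∧ R.2 ≤ Real.logb 2 (k2 : ℝ) / (n : ℝ) ∧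
        errP2 W n k1 k2 f g1 g2 ≤ ε

/-- Achievability of a rate pair with no receiver side information. -/
def Ach0 (W : X → Y1 × Y2 → ℝ) (R : ℝ × ℝ) : Prop :=
  0 ≤ R.1 ∧ 0 ≤ R.2 ∧ ∀ ε : ℝ, 0 < ε →
    ∃ (n k1 k2 : ℕ), 0 < n ∧ 0 < k1 ∧ 0 < k2 ∧
      ∃ (f : Fin k1 × Fin k2 → Fin n → X) (g1 : (Fin n → Y1) → Fin k1)
        (g2 : (Fin n → Y2) → Fin k2),
        R.1 ≤ Real.logb 2 (k1 : ℝ) / (n : ℝ) ∧ R.2 ≤ Real.logb 2 (k2 : ℝ) / (n : ℝ) ∧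
        errP0 W n k1 k2 f g1 g2 ≤ ε

/-- Capacity region `𝒞₁`: side information `M2` at receiver 1. -/
def Cap1 (W : X → Y1 × Y2 → ℝ) : Set (ℝ × ℝ) := closure {R | Ach1 W R}

/-- Capacity region `𝒞₂`: side information `M1` at receiver 2. -/
def Cap2 (W : X → Y1 × Y2 → ℝ) : Set (ℝ × ℝ) := closure {R | Ach2 W R}

/-- Private-message capacity region `𝒞`. -/
def Cap (W : X → Y1 × Y2 → ℝ) : Set (ℝ × ℝ) := closure {R | Ach0 W R}

end Channel

/-- `κ·𝒜` for a set of rate pairs. -/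
def scaleSet (κ : ℝ) (A : Set (ℝ × ℝ)) : Set (ℝ × ℝ) :=
  (fun R : ℝ × ℝ => (κ * R.1, κ * R.2)) '' A

/-- Binary entropy function (base 2). -/
def Hb (x : ℝ) : ℝ := -(x * Real.logb 2 x) - (1 - x) * Real.logb 2 (1 - x)

/-- Binary convolution `a*b = a(1-b)+(1-a)b`. -/
def bconv (a b : ℝ) : ℝ := a * (1 - b) + (1 - a) * b

/-- The region `𝒞(BS-BC(d₁,d₂))`. -/
def CBSBC (d1 d2 : ℝ) : Set (ℝ × ℝ) :=
  {R | 0 ≤ R.1 ∧ 0 ≤ R.2 ∧ ∃ α ∈ Set.Icc (0:ℝ) (1/2),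
    R.1 ≤ Hb (bconv α d1) - Hb d1 ∧ R.2 ≤ 1 - Hb (bconv α d2)}

/-- The region `𝒞(BE-BC(ε₁,ε₂))`. -/
def CBEBC (e1 e2 : ℝ) : Set (ℝ × ℝ) :=
  {R | 0 ≤ R.1 ∧ 0 ≤ R.2 ∧ ∃ β ∈ Set.Icc (0:ℝ) 1,
    R.1 ≤ β * (1 - e1) ∧ R.2 ≤ (1 - β) * (1 - e2)}

/-- 1-norm distance between two functions on a finite type. -/
def l1dist {α : Type} [Fintype α] (p q : α → ℝ) : ℝ := ∑ a, |p a - q a|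

/-- Capacity `C(p_{Y|X}) = max_{p_X} I(X;Y)` of a point-to-point channel. -/
def Cmarg {X Y : Type} [Fintype X] [Fintype Y] (Wm : X → Y → ℝ) : ℝ :=
  sSup {r | ∃ pX : X → ℝ, IsPMF pX ∧ r = MI (fun a : X × Y => pX a.1 * Wm a.1 a.2)}

/-- Transition kernel of the binary symmetric channel `BSC(p)`. -/
def BSCk (p : ℝ) : Bool → Bool → ℝ := fun x y => if y = x then 1 - p else p

/-- Transition kernel of the binary erasure channel `BEC(ε)`
(`none` is the erasure symbol). -/
def BECk (e : ℝ) : Bool → Option Bool → ℝ :=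
  fun x y => match y with
    | none => e
    | some b => if b = x then 1 - e else 0

lemma Hb_eq_bin (x : ℝ) : Hb x = Real.binEntropy x / Real.log 2 := by
  unfold Hb Real.logb
  rw [Real.binEntropy_eq_negMulLog_add_negMulLog_one_sub]
  unfold Real.negMulLog
  ring

lemma Hb_nonneg {x : ℝ} (h0 : 0 ≤ x) (h1 : x ≤ 1) : 0 ≤ Hb x := by
  rw [Hb_eq_bin]
  have := Real.binEntropy_nonneg h0 h1
  have := Real.log_pos (by norm_num : (1:ℝ) < 2)
  positivity

lemma Hb_le_one (x : ℝ) : Hb x ≤ 1 := by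
  rw [Hb_eq_bin]
  have := Real.log_pos (by norm_num : (1:ℝ) < 2)
  rw [div_le_one this]
  exact Real.binEntropy_le_log_two

/-- `φ(a) = log 2 - h((1-a)/2)` in nats. -/
def phi (a : ℝ) : ℝ := Real.log 2 - Real.binEntropy ((1 - a) / 2)

def cser (k : ℕ) : ℝ := 1 / ((2 * k + 1) * (2 * k + 2))

lemma cser_nonneg (k : ℕ) : 0 ≤ cser k := by unfold cser; positivity

lemma phi_hasSum {a : ℝ} (ha : |a| < 1) :
    HasSum (fun k : ℕ => cser k * (a ^ 2) ^ (k + 1)) (phi a) := by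
  have h1 := Real.hasSum_log_sub_log_of_abs_lt_one ha
  have ha2 : |a ^ 2| < 1 := by
    rw [abs_pow]; exact pow_lt_one₀ (abs_nonneg a) ha (by norm_num)
  have h2 := Real.hasSum_pow_div_log_of_abs_lt_one ha2
  obtain ⟨l, u⟩ := abs_lt.mp ha
  have e1 : Real.log (1 - a ^ 2) = Real.log (1 + a) + Real.log (1 - a) := by
    rw [← Real.log_mul (by linarith) (by linarith)]; congr 1; ring
  have h3 := (h1.mul_left (a / 2)).sub (h2.mul_left (1 / 2))
  have e2 : phi a = a / 2 * (Real.log (1 + a) - Real.log (1 - a))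
      - 1 / 2 * -Real.log (1 - a ^ 2) := by
    unfold phi
    rw [Real.binEntropy_eq_negMulLog_add_negMulLog_one_sub]
    unfold Real.negMulLog
    have : 1 - (1 - a) / 2 = (1 + a) / 2 := by ring
    rw [this, Real.log_div (by linarith) (by norm_num), Real.log_div (by linarith) (by norm_num),
      e1]
    ring
  rw [e2]
  suffices e3 : (fun k : ℕ => cser k * (a ^ 2) ^ (k + 1)) = fun b : ℕ =>
      a / 2 * (2 * (1 / (2 * (b:ℝ) + 1)) * a ^ (2 * b + 1))
        - 1 / 2 * ((a ^ 2) ^ (b + 1) / ((b:ℝ) + 1)) by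
    rw [e3]; exact h3
  funext k
  unfold cser
  have : (2 * (k:ℝ) + 1) ≠ 0 := by positivity
  have : ((k:ℝ) + 1) ≠ 0 := by positivity
  have : (2 * (k:ℝ) + 2) ≠ 0 := by positivity
  field_simp
  ring

lemma phi_le (a : ℝ) (ha : |a| ≤ 1) : phi a ≤ Real.log 2 := by
  unfold phi
  obtain ⟨l, u⟩ := abs_le.mp ha
  have := Real.binEntropy_nonneg (p := (1 - a) / 2) (by linarith) (by linarith)
  linarith

lemma cser_sum_le (N : ℕ) : ∑ k ∈ range N, cser k ≤ Real.log 2 := by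
  have hc : Filter.Tendsto (fun x : ℝ => ∑ k ∈ range N, cser k * (x ^ 2) ^ (k + 1))
      (nhdsWithin 1 (Set.Iio 1)) (nhds (∑ k ∈ range N, cser k * ((1:ℝ) ^ 2) ^ (k + 1))) := by
    apply tendsto_nhdsWithin_of_tendsto_nhds
    apply Continuous.tendsto (f := fun x : ℝ => ∑ k ∈ range N, cser k * (x ^ 2) ^ (k + 1))
    fun_prop
  simp only [one_pow, mul_one] at hc
  refine le_of_tendsto hc ?_
  have : Set.Ioo (0:ℝ) 1 ∈ nhdsWithin (1:ℝ) (Set.Iio 1) := Ioo_mem_nhdsLT (by norm_num)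
  filter_upwards [this] with x hx
  have hx' : |x| < 1 := by rw [abs_of_pos hx.1]; exact hx.2
  refine le_trans ?_ (phi_le x hx'.le)
  exact sum_le_hasSum _ (fun k _ => mul_nonneg (cser_nonneg k) (by positivity)) (phi_hasSum hx')

lemma cheb_fin (N : ℕ) {x y : ℝ} (hx0 : 0 ≤ x) (hx1 : x ≤ 1) (hy0 : 0 ≤ y) (hy1 : y ≤ 1) :
    (∑ k ∈ range N, cser k * x ^ (k + 1)) * (∑ k ∈ range N, cser k * y ^ (k + 1)) ≤
      (∑ k ∈ range N, cser k) * (∑ k ∈ range N, cser k * (x * y) ^ (k + 1)) := by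
  have h : 0 ≤ ∑ j ∈ range N, ∑ k ∈ range N,
      cser j * cser k * ((x ^ (j+1) - x ^ (k+1)) * (y ^ (j+1) - y ^ (k+1))) := by
    refine sum_nonneg fun j _ => sum_nonneg fun k _ => ?_
    refine mul_nonneg (mul_nonneg (cser_nonneg _) (cser_nonneg _)) ?_
    rcases le_total j k with h | h
    · exact mul_nonneg (sub_nonneg.2 (pow_le_pow_of_le_one hx0 hx1 (by omega)))
        (sub_nonneg.2 (pow_le_pow_of_le_one hy0 hy1 (by omega)))
    · exact mul_nonneg_of_nonpos_of_nonpos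
        (sub_nonpos.2 (pow_le_pow_of_le_one hx0 hx1 (by omega)))
        (sub_nonpos.2 (pow_le_pow_of_le_one hy0 hy1 (by omega)))
  have e : ∑ j ∈ range N, ∑ k ∈ range N,
      cser j * cser k * ((x ^ (j+1) - x ^ (k+1)) * (y ^ (j+1) - y ^ (k+1)))
      = 2 * ((∑ k ∈ range N, cser k) * (∑ k ∈ range N, cser k * (x * y) ^ (k + 1)))
       - 2 * ((∑ k ∈ range N, cser k * x ^ (k + 1)) * (∑ k ∈ range N, cser k * y ^ (k + 1))) := by
    have a1 : ∑ j ∈ range N, ∑ k ∈ range N,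
      cser j * cser k * ((x ^ (j+1) - x ^ (k+1)) * (y ^ (j+1) - y ^ (k+1)))
      = ∑ j ∈ range N, ∑ k ∈ range N, (cser j * (x*y)^(j+1) * cser k + cser j * (cser k * (x*y)^(k+1))
        - cser j * x^(j+1) * (cser k * y ^(k+1)) - cser j * y^(j+1) * (cser k * x ^(k+1))) := by
      refine sum_congr rfl fun j _ => sum_congr rfl fun k _ => ?_
      rw [mul_pow, mul_pow]; ring
    rw [a1]
    simp only [sum_sub_distrib, sum_add_distrib, ← sum_mul_sum]
    ring
  linarith

lemma phi_mul {a b : ℝ} (ha : |a| < 1) (hb : |b| < 1) :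
    phi a * phi b ≤ Real.log 2 * phi (a * b) := by
  have hab : |a * b| < 1 := by
    rw [abs_mul]
    exact mul_lt_one_of_nonneg_of_lt_one_left (abs_nonneg a) ha hb.le
  have t1 := (phi_hasSum ha).tendsto_sum_nat.mul (phi_hasSum hb).tendsto_sum_nat
  have t2 := (phi_hasSum hab).tendsto_sum_nat.const_mul (Real.log 2)
  refine le_of_tendsto_of_tendsto' t1 t2 fun N => ?_
  have hx : ∀ {a : ℝ}, |a| < 1 → a ^ 2 ≤ 1 := fun h => by
    rw [← sq_abs]; exact pow_le_one₀ (abs_nonneg _) h.le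
  refine (cheb_fin N (sq_nonneg a) (hx ha) (sq_nonneg b) (hx hb)).trans ?_
  rw [mul_pow]
  exact mul_le_mul_of_nonneg_right (cser_sum_le N)
    (sum_nonneg fun k _ => mul_nonneg (cser_nonneg k) (by positivity))

lemma Hb_zero : Hb 0 = 0 := by simp [Hb_eq_bin]
lemma Hb_one : Hb 1 = 0 := by simp [Hb_eq_bin]
lemma Hb_symm (x : ℝ) : Hb (1 - x) = Hb x := by simp [Hb_eq_bin]

lemma Hb_bconv {p q : ℝ} (hp0 : 0 ≤ p) (hp1 : p ≤ 1) (hq0 : 0 ≤ q) (hq1 : q ≤ 1) :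
    (1 - Hb p) * (1 - Hb q) ≤ 1 - Hb (bconv q p) := by
  unfold bconv
  rcases hp0.eq_or_lt with rfl | hp0
  · simp [Hb_zero]
  rcases hp1.eq_or_lt with rfl | hp1
  · simp [Hb_one, Hb_symm]
  rcases hq0.eq_or_lt with rfl | hq0
  · simp [Hb_zero]
  rcases hq1.eq_or_lt with rfl | hq1
  · simp [Hb_one, Hb_symm]
  have hl := Real.log_pos (by norm_num : (1:ℝ) < 2)
  have h := phi_mul (a := 1 - 2 * p) (b := 1 - 2 * q) (abs_lt.2 ⟨by linarith, by linarith⟩)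
    (abs_lt.2 ⟨by linarith, by linarith⟩)
  unfold phi at h
  have e1 : (1 - (1 - 2 * p)) / 2 = p := by ring
  have e2 : (1 - (1 - 2 * q)) / 2 = q := by ring
  have e3 : (1 - (1 - 2 * p) * (1 - 2 * q)) / 2 = q * (1 - p) + (1 - q) * p := by ring
  rw [e1, e2, e3] at h
  rw [Hb_eq_bin, Hb_eq_bin, Hb_eq_bin]
  have : ∀ z, 1 - z / Real.log 2 = (Real.log 2 - z) / Real.log 2 := fun z => by
    field_simp
  rw [this, this, this, div_mul_div_comm, div_le_div_iff₀ (by positivity) hl]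
  nlinarith


/-- Output distribution of channel `W` under (unnormalized) input `g`. -/
def push {X Y : Type} [Fintype X] (g : X → ℝ) (W : X → Y → ℝ) : Y → ℝ :=
  fun y => ∑ x, g x * W x y

/-- `n`-fold product of a channel. -/
def nF {ι X Y : Type} [Fintype ι] (W : X → Y → ℝ) (x : ι → X) (y : ι → Y) : ℝ :=
  ∏ t, W (x t) (y t)

lemma Hent_scale {α : Type} [Fintype α] (s : ℝ) (p : α → ℝ) :
    Hent (fun a => s * p a) = s * Hent p - (∑ a, p a) * (s * Real.logb 2 s) := by
  unfold Hent
  rcases eq_or_ne s 0 with rfl | hs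
  · simp
  have : ∀ a, s * p a * Real.logb 2 (s * p a)
      = s * (p a * Real.logb 2 (p a)) + p a * (s * Real.logb 2 s) := by
    intro a
    rcases eq_or_ne (p a) 0 with h | h
    · simp [h]
    rw [Real.logb_mul hs h]; ring
  simp only [this, sum_add_distrib, ← mul_sum, ← sum_mul]
  ring

lemma Hent_equiv {α β : Type} [Fintype α] [Fintype β] (e : α ≃ β) (p : β → ℝ) :
    Hent (fun a => p (e a)) = Hent p := by
  unfold Hent
  rw [← Equiv.sum_comp e (fun b => p b * Real.logb 2 (p b))]

lemma Hent_prod_type {α β : Type} [Fintype α] [Fintype β] (p : α × β → ℝ) :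
    Hent p = ∑ b, Hent (fun a => p (a, b)) := by
  unfold Hent
  rw [Fintype.sum_prod_type_right, sum_neg_distrib]

lemma Hent_prod_type' {α β : Type} [Fintype α] [Fintype β] (p : α × β → ℝ) :
    Hent p = ∑ a, Hent (fun b => p (a, b)) := by
  unfold Hent
  rw [Fintype.sum_prod_type, sum_neg_distrib]

lemma push_sum {X Y : Type} [Fintype X] [Fintype Y] {W : X → Y → ℝ} (hW : IsChannel W)
    (g : X → ℝ) : ∑ y, push g W y = ∑ x, g x := by
  unfold push
  rw [sum_comm]
  refine sum_congr rfl fun x _ => ?_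
  rw [← mul_sum, (hW x).2, mul_one]

lemma push_nonneg {X Y : Type} [Fintype X] [Fintype Y] {W : X → Y → ℝ} (hW : IsChannel W)
    {g : X → ℝ} (hg : ∀ x, 0 ≤ g x) (y : Y) : 0 ≤ push g W y :=
  sum_nonneg fun x _ => mul_nonneg (hg x) ((hW x).1 y)

lemma push_pmf {X Y : Type} [Fintype X] [Fintype Y] {W : X → Y → ℝ} (hW : IsChannel W)
    {g : X → ℝ} (hg : IsPMF g) : IsPMF (push g W) :=
  ⟨push_nonneg hW hg.1, by rw [push_sum hW, hg.2]⟩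

/-- Entropy gap between two channels from the same input. -/
def EntGap {X Y1 Y2 : Type} [Fintype X] [Fintype Y1] [Fintype Y2]
    (W1 : X → Y1 → ℝ) (W2 : X → Y2 → ℝ) (c : ℝ) : Prop :=
  ∀ g : X → ℝ, (∀ x, 0 ≤ g x) → c * ∑ x, g x ≤ Hent (push g W2) - Hent (push g W1)

lemma EntGap_of_pmf {X Y1 Y2 : Type} [Fintype X] [Fintype Y1] [Fintype Y2]
    {W1 : X → Y1 → ℝ} {W2 : X → Y2 → ℝ} (h1 : IsChannel W1) (h2 : IsChannel W2) {c : ℝ}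
    (h : ∀ g, IsPMF g → c ≤ Hent (push g W2) - Hent (push g W1)) : EntGap W1 W2 c := by
  intro g hg
  set s := ∑ x, g x with hs
  rcases (sum_nonneg fun x (_ : x ∈ univ) => hg x).eq_or_lt with h0 | h0
  · have : ∀ x, g x = 0 := by
      have := (sum_eq_zero_iff_of_nonneg fun x (_ : x ∈ univ) => hg x).1 h0.symm
      intro x; exact this x (mem_univ x)
    have e1 : push g W1 = fun _ => 0 := by funext y; simp [push, this]
    have e2 : push g W2 = fun _ => 0 := by funext y; simp [push, this]
    rw [e1, e2, hs, ← h0]; simp [Hent]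
  · rw [← hs] at h0
    have hpm : IsPMF (fun x => s⁻¹ * g x) :=
      ⟨fun x => mul_nonneg (by positivity) (hg x), by
        rw [← mul_sum, ← hs, inv_mul_cancel₀ h0.ne']⟩
    have h' := h _ hpm
    have e : ∀ {Y : Type} [Fintype Y] {W : X → Y → ℝ}, IsChannel W →
        Hent (push g W) = s * Hent (push (fun x => s⁻¹ * g x) W) - s * Real.logb 2 s := by
      intro Y _ W hW
      have : push g W = fun y => s * push (fun x => s⁻¹ * g x) W y := by
        funext y
        unfold push
        rw [mul_sum]
        refine sum_congr rfl fun x _ => ?_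
        field_simp
      rw [this, Hent_scale, push_sum hW, hpm.2, one_mul]
    rw [e h1, e h2]
    nlinarith

/-- Product channel. -/
def prodCh {X X' Y Y' : Type} (W : X → Y → ℝ) (V : X' → Y' → ℝ) : X × X' → Y × Y' → ℝ :=
  fun x y => W x.1 y.1 * V x.2 y.2

lemma EntGap.prod {X X' Y1 Y2 Y1' Y2' : Type} [Fintype X] [Fintype X'] [Fintype Y1] [Fintype Y2]
    [Fintype Y1'] [Fintype Y2']
    {W1 : X → Y1 → ℝ} {W2 : X → Y2 → ℝ} {V1 : X' → Y1' → ℝ} {V2 : X' → Y2' → ℝ}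
    (h1 : IsChannel W1) (h2' : IsChannel V2) {c d : ℝ}
    (hc : EntGap W1 W2 c) (hd : EntGap V1 V2 d) :
    EntGap (prodCh W1 V1) (prodCh W2 V2) (c + d) := by
  intro g hg
  have A : ∀ {Y Y' : Type} [Fintype Y] [Fintype Y'] (W : X → Y → ℝ) (V : X' → Y' → ℝ),
      Hent (push g (prodCh W V)) = ∑ y', Hent (push (fun x => ∑ x', g (x, x') * V x' y') W) := by
    intro Y Y' _ _ W V
    rw [Hent_prod_type]
    refine sum_congr rfl fun y' _ => ?_
    congr 1
    funext y
    unfold push prodCh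
    rw [Fintype.sum_prod_type]
    refine sum_congr rfl fun x _ => ?_
    rw [sum_mul]
    refine sum_congr rfl fun x' _ => ?_
    ring
  have B : ∀ {Y Y' : Type} [Fintype Y] [Fintype Y'] (W : X → Y → ℝ) (V : X' → Y' → ℝ),
      Hent (push g (prodCh W V)) = ∑ y, Hent (push (fun x' => ∑ x, g (x, x') * W x y) V) := by
    intro Y Y' _ _ W V
    rw [Hent_prod_type']
    refine sum_congr rfl fun y' _ => ?_
    congr 1
    funext y
    unfold push prodCh
    rw [Fintype.sum_prod_type_right]
    refine sum_congr rfl fun x _ => ?_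
    rw [sum_mul]
    refine sum_congr rfl fun x' _ => ?_
    ring
  have t1 : c * ∑ x, g x ≤ Hent (push g (prodCh W2 V2)) - Hent (push g (prodCh W1 V2)) := by
    rw [A, A, ← sum_sub_distrib]
    have : ∑ x, g x = ∑ y' : Y2', ∑ x, ∑ x', g (x, x') * V2 x' y' := by
      rw [sum_comm, Fintype.sum_prod_type]
      refine sum_congr rfl fun x _ => ?_
      rw [sum_comm]
      refine sum_congr rfl fun x' _ => ?_
      rw [← mul_sum, (h2' x').2, mul_one]
    rw [this, mul_sum]
    exact sum_le_sum fun y' _ => hc _ fun x =>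
      sum_nonneg fun x' _ => mul_nonneg (hg _) ((h2' x').1 _)
  have t2 : d * ∑ x, g x ≤ Hent (push g (prodCh W1 V2)) - Hent (push g (prodCh W1 V1)) := by
    rw [B, B, ← sum_sub_distrib]
    have : ∑ x, g x = ∑ y : Y1, ∑ x', ∑ x, g (x, x') * W1 x y := by
      rw [sum_comm, Fintype.sum_prod_type_right]
      refine sum_congr rfl fun x _ => ?_
      rw [sum_comm]
      refine sum_congr rfl fun x' _ => ?_
      rw [← mul_sum, (h1 x').2, mul_one]
    rw [this, mul_sum]
    exact sum_le_sum fun y' _ => hd _ fun x =>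
      sum_nonneg fun x' _ => mul_nonneg (hg _) ((h1 x').1 _)
  linarith

lemma nF_channel {ι X Y : Type} [Fintype ι] [DecidableEq ι] [Fintype Y] {W : X → Y → ℝ} (hW : IsChannel W) :
    IsChannel (nF (ι := ι) W) := by
  intro x
  refine ⟨fun y => prod_nonneg fun t _ => (hW _).1 _, ?_⟩
  unfold nF
  rw [← Fintype.prod_sum (fun t y => W (x t) y)]
  exact prod_eq_one fun t _ => (hW _).2

def consE (X : Type) (n : ℕ) : (Fin (n + 1) → X) ≃ X × (Fin n → X) :=
  (Fin.consEquiv (fun _ : Fin (n + 1) => X)).symm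

lemma nF_succ {X Y : Type} (W : X → Y → ℝ) (n : ℕ) (x : Fin (n+1) → X) (y : Fin (n+1) → Y) :
    nF W x y = prodCh W (nF (ι := Fin n) W) ((consE X n) x)
      ((consE Y n) y) := by
  unfold nF prodCh
  rw [Fin.prod_univ_succ]
  rfl

lemma EntGap.equiv {X X' Y1 Y2 Y1' Y2' : Type} [Fintype X] [Fintype X'] [Fintype Y1] [Fintype Y2]
    [Fintype Y1'] [Fintype Y2'] {W1 : X → Y1 → ℝ} {W2 : X → Y2 → ℝ} {c : ℝ}
    (h : EntGap W1 W2 c) (ex : X' ≃ X) (e1 : Y1' ≃ Y1) (e2 : Y2' ≃ Y2) :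
    EntGap (fun x y => W1 (ex x) (e1 y)) (fun x y => W2 (ex x) (e2 y)) c := by
  intro g hg
  have := h (fun x => g (ex.symm x)) (fun x => hg _)
  rw [Equiv.sum_comp ex.symm g] at this
  refine this.trans (le_of_eq ?_)
  have A : ∀ {Y Y' : Type} [Fintype Y] [Fintype Y'] (e : Y' ≃ Y) (W : X → Y → ℝ),
      Hent (push g (fun x y => W (ex x) (e y))) = Hent (push (fun x => g (ex.symm x)) W) := by
    intro Y Y' _ _ e W
    rw [← Hent_equiv e]
    congr 1
    funext y
    unfold push
    rw [← Equiv.sum_comp ex]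
    simp
  rw [A e1, A e2]

lemma EntGap.nfold {X Y1 Y2 : Type} [Fintype X] [Fintype Y1] [Fintype Y2]
    {W1 : X → Y1 → ℝ} {W2 : X → Y2 → ℝ} (h1 : IsChannel W1) (h2 : IsChannel W2) {c : ℝ}
    (hc : EntGap W1 W2 c) (n : ℕ) :
    EntGap (nF (ι := Fin n) W1) (nF (ι := Fin n) W2) (n * c) := by
  induction n with
  | zero =>
    intro g hg
    unfold _root_.nF push
    simp [Hent]
  | succ n ih =>
    have h3 := hc.prod h1 (nF_channel h2) ih
    have := h3.equiv (consE X n)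
      (consE Y1 n) (consE Y2 n)
    convert this using 1
    · funext x y; exact nF_succ _ _ _ _
    · funext x y; exact nF_succ _ _ _ _
    · push_cast; ring

lemma Hent_indep {α β : Type} [Fintype α] [Fintype β] {p : α → ℝ} {q : β → ℝ}
    (hp : ∑ a, p a = 1) (hq : ∑ b, q b = 1) :
    Hent (fun z : α × β => p z.1 * q z.2) = Hent p + Hent q := by
  rw [Hent_prod_type']
  simp only [Hent_scale, sum_sub_distrib, ← sum_mul, hp, hq, one_mul]
  unfold Hent
  ring

lemma Hent_pi {Y : Type} [Fintype Y] (n : ℕ) (P : Fin n → Y → ℝ) (hP : ∀ t, ∑ y, P t y = 1) :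
    Hent (fun y : Fin n → Y => ∏ t, P t (y t)) = ∑ t, Hent (P t) := by
  induction n with
  | zero => simp [Hent]
  | succ n ih =>
    rw [Fin.sum_univ_succ, ← ih _ (fun t => hP _), ← Hent_indep (hP 0), ← Hent_equiv
      (consE Y n)]
    · congr 1
      funext y
      rw [Fin.prod_univ_succ]
      rfl
    · rw [← Fintype.prod_sum (fun t y => P (Fin.succ t) y)]
      exact prod_eq_one fun t _ => hP _

lemma gibbs {α : Type} [Fintype α] {P R : α → ℝ} (hP : ∀ a, 0 ≤ P a) (hR : ∀ a, 0 ≤ R a)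
    (hPR : ∀ a, P a ≠ 0 → R a ≠ 0) (hs : ∑ a, R a ≤ ∑ a, P a) :
    ∑ a, P a * Real.logb 2 (R a) ≤ ∑ a, P a * Real.logb 2 (P a) := by
  have hl := Real.log_pos (by norm_num : (1:ℝ) < 2)
  have key : ∀ a, P a * Real.logb 2 (R a) - P a * Real.logb 2 (P a)
      ≤ (R a - P a) / Real.log 2 := by
    intro a
    rcases (hP a).eq_or_lt with h | h
    · rw [← h]; simp; exact div_nonneg (hR a) hl.le
    · have hr : 0 < R a := lt_of_le_of_ne (hR a) (hPR a h.ne').symm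
      have := Real.log_le_sub_one_of_pos (div_pos hr h)
      rw [Real.log_div hr.ne' h.ne'] at this
      unfold Real.logb
      rw [← mul_sub, ← sub_div, mul_div_assoc', div_le_div_iff_of_pos_right hl]
      have h2 := mul_le_mul_of_nonneg_left this h.le
      have : P a * (R a / P a - 1) = R a - P a := by field_simp
      linarith
  have := sum_le_sum fun a (_ : a ∈ univ) => key a
  rw [sum_sub_distrib, ← sum_div, sum_sub_distrib] at this
  have h3 : (∑ a, R a - ∑ a, P a) / Real.log 2 ≤ 0 :=
    div_nonpos_of_nonpos_of_nonneg (by linarith) hl.le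
  linarith

/-- error function in the Fano inequality -/
def fanoD (l : ℝ) : ℝ := -Real.logb 2 (1 - l) - l * Real.logb 2 l

lemma fano {M Z : Type} [Fintype M] [Fintype Z] (J : M × Z → ℝ) (hJ : IsPMF J) (g : Z → M)
    {l : ℝ} (hl0 : 0 < l) (hl1 : l < 1)
    (herr : ∑ z, J z * (if g z.2 = z.1 then 0 else 1) ≤ l) :
    Hent J - Hent (fun z => ∑ m, J (m, z))
      ≤ fanoD l + l * Real.logb 2 (Fintype.card M) := by
  have hne : Nonempty M := by
    by_contra hn
    rw [not_nonempty_iff] at hn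
    have := hJ.2
    simp at this
  have hk : (1:ℝ) ≤ Fintype.card M := by exact_mod_cast Fintype.card_pos
  set k : ℝ := ((Fintype.card M : ℕ) : ℝ) with hkd
  set Q : Z → ℝ := fun z => ∑ m, J (m, z) with hQ
  have hQ0 : ∀ z, 0 ≤ Q z := fun z => sum_nonneg fun m _ => hJ.1 _
  set rho : M × Z → ℝ := fun z => if g z.2 = z.1 then 1 - l else l / k with hrho
  have hrp : ∀ z, 0 < rho z := by
    intro z; simp only [hrho]; split_ifs
    · linarith
    · positivity
  have hJQ : ∀ z, J z ≠ 0 → Q z.2 ≠ 0 := by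
    intro z hz
    have : J z ≤ Q z.2 := by
      have := single_le_sum (f := fun m => J (m, z.2)) (fun m _ => hJ.1 _) (mem_univ z.1)
      exact this
    have h0 := lt_of_le_of_ne (hJ.1 z) hz.symm
    linarith
  have hQs : ∑ z, Q z = 1 := by
    rw [← hJ.2, Fintype.sum_prod_type_right]
  have g1 := gibbs (P := J) (R := fun z => Q z.2 * rho z) hJ.1
    (fun z => mul_nonneg (hQ0 _) (hrp z).le)
    (fun z hz => mul_ne_zero (hJQ z hz) (hrp z).ne') (by
      rw [hJ.2, ← hQs, Fintype.sum_prod_type_right]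
      refine sum_le_sum fun z _ => ?_
      change ∑ x, Q z * rho (x, z) ≤ Q z
      rw [← mul_sum]
      have : ∑ m, rho (m, z) ≤ 1 := by
        have h1 : ∀ m, rho (m, z) ≤ (if g z = m then 1 - l else 0) + l / k := by
          intro m; simp only [hrho]
          have : 0 ≤ l / k := by positivity
          split_ifs <;> linarith
        refine (sum_le_sum fun m _ => h1 m).trans ?_
        rw [sum_add_distrib]
        simp
        rw [← hkd]
        field_simp
        linarith
      nlinarith [hQ0 z])
  have g2 : ∀ z, J z * Real.logb 2 (Q z.2 * rho z)
      = J z * Real.logb 2 (Q z.2) + J z * Real.logb 2 (rho z) := by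
    intro z
    rcases eq_or_ne (J z) 0 with h | h
    · simp [h]
    · rw [Real.logb_mul (hJQ z h) (hrp z).ne']; ring
  simp only [g2, sum_add_distrib] at g1
  have g3 : ∑ z, J z * Real.logb 2 (Q z.2) = - Hent Q := by
    unfold Hent
    rw [neg_neg, Fintype.sum_prod_type_right]
    refine sum_congr rfl fun z _ => ?_
    change ∑ x, J (x, z) * Real.logb 2 (Q z) = _
    rw [← sum_mul]
  have l1 : Real.logb 2 (1 - l) ≤ 0 := Real.logb_nonpos (by norm_num) (by linarith) (by linarith)
  have l2 : Real.logb 2 (l / k) ≤ 0 := Real.logb_nonpos (by norm_num) (by positivity) (by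
    rw [div_le_one (by linarith)]; linarith)
  have g4 : Real.logb 2 (1 - l) + l * Real.logb 2 (l / k) ≤ ∑ z, J z * Real.logb 2 (rho z) := by
    have a1 : ∀ z, J z * Real.logb 2 (1 - l)
        + (J z * (if g z.2 = z.1 then 0 else 1)) * Real.logb 2 (l / k)
        ≤ J z * Real.logb 2 (rho z) := by
      intro z
      have := hJ.1 z
      simp only [hrho]
      split_ifs
      · simp
      · nlinarith
    have a2 := sum_le_sum fun z (_ : z ∈ univ) => a1 z
    rw [sum_add_distrib, ← sum_mul, ← sum_mul, hJ.2] at a2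
    nlinarith
  rw [Real.logb_div hl0.ne' (by linarith)] at g4
  unfold fanoD
  have : Hent J = - ∑ a, J a * Real.logb 2 (J a) := rfl
  linarith


/-- uniform average over a finite type -/
def avg {B : Type} [Fintype B] (f : B → ℝ) : ℝ := ((Fintype.card B : ℕ) : ℝ)⁻¹ * ∑ b, f b

lemma avg_mono {B : Type} [Fintype B] {f g : B → ℝ} (h : ∀ b, f b ≤ g b) : avg f ≤ avg g :=
  mul_le_mul_of_nonneg_left (sum_le_sum fun b _ => h b) (by positivity)

lemma avg_nonneg {B : Type} [Fintype B] {f : B → ℝ} (h : ∀ b, 0 ≤ f b) : 0 ≤ avg f :=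
  mul_nonneg (by positivity) (sum_nonneg fun b _ => h b)

lemma avg_add {B : Type} [Fintype B] (f g : B → ℝ) :
    avg (fun b => f b + g b) = avg f + avg g := by
  unfold avg; rw [sum_add_distrib, mul_add]

lemma avg_mul_left {B : Type} [Fintype B] (s : ℝ) (f : B → ℝ) :
    avg (fun b => s * f b) = s * avg f := by
  unfold avg; rw [← mul_sum]; ring

lemma avg_mul_right {B : Type} [Fintype B] (s : ℝ) (f : B → ℝ) :
    avg (fun b => f b * s) = avg f * s := by
  unfold avg; rw [← sum_mul]; ring

lemma avg_sum {B Y : Type} [Fintype B] (S : Finset Y) (f : B → Y → ℝ) :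
    avg (fun b => ∑ y ∈ S, f b y) = ∑ y ∈ S, avg (fun b => f b y) := by
  unfold avg; rw [sum_comm, mul_sum]

lemma avg_const {B : Type} [Fintype B] [Nonempty B] (s : ℝ) : avg (fun _ : B => s) = s := by
  unfold avg
  rw [sum_const, card_univ, nsmul_eq_mul, inv_mul_cancel_left₀]
  exact_mod_cast Fintype.card_ne_zero

lemma avg_prod {A B : Type} [Fintype A] [Fintype B] (f : A × B → ℝ) :
    avg f = avg (fun a => avg (fun b => f (a, b))) := by
  unfold avg
  rw [Fintype.sum_prod_type, Fintype.card_prod, ← mul_sum]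
  push_cast
  rw [mul_inv]; ring

lemma avg_comm {A B : Type} [Fintype A] [Fintype B] (f : A → B → ℝ) :
    avg (fun a => avg (fun b => f a b)) = avg (fun b => avg (fun a => f a b)) := by
  unfold avg
  rw [← mul_sum, ← mul_sum, sum_comm]; ring

lemma avg_equiv {A B : Type} [Fintype A] [Fintype B] (e : A ≃ B) (f : B → ℝ) :
    avg (fun a => f (e a)) = avg f := by
  unfold avg
  rw [Equiv.sum_comp e f, Fintype.card_congr e]

lemma avg_coord {M B : Type} [Fintype M] [DecidableEq M] [Fintype B] [Nonempty B] (i : M)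
    (f : B → ℝ) : avg (fun c : M → B => f (c i)) = avg f := by
  have := avg_equiv (Equiv.funSplitAt i B) (fun z => f z.1)
  refine Eq.trans ?_ (this.trans ?_)
  · rfl
  · rw [avg_prod]; simp only [avg_const]

lemma avg_coord2 {M B : Type} [Fintype M] [DecidableEq M] [Fintype B] [Nonempty B] {i j : M}
    (hij : j ≠ i) (f : B → B → ℝ) :
    avg (fun c : M → B => f (c i) (c j)) = avg (fun b => avg (fun b' => f b b')) := by
  have := avg_equiv (Equiv.funSplitAt i B) (fun z => f z.1 (z.2 ⟨j, hij⟩))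
  refine Eq.trans ?_ (this.trans ?_)
  · rfl
  · rw [avg_prod]
    congr 1
    funext b
    exact avg_coord (M := {j // j ≠ i}) ⟨j, hij⟩ (f b)

lemma avg_pi {ι A : Type} [Fintype ι] [DecidableEq ι] [Fintype A] (h : ι → A → ℝ) :
    ∏ t, avg (h t) = avg (fun a : ι → A => ∏ t, h t (a t)) := by
  unfold avg
  rw [prod_mul_distrib, Fintype.prod_sum, Fintype.card_pi]
  simp

lemma exists_le_avg {B : Type} [Fintype B] [Nonempty B] {f : B → ℝ} {s : ℝ} (h : avg f ≤ s) :
    ∃ b, f b ≤ s := by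
  by_contra! hc
  obtain ⟨b0⟩ := ‹Nonempty B›
  have h1 : ∑ _b : B, s < ∑ b, f b := sum_lt_sum_of_nonempty ⟨b0, mem_univ _⟩ fun b _ => hc b
  have h2 : avg (fun _ : B => s) < avg f :=
    mul_lt_mul_of_pos_left h1 (inv_pos.2 (by exact_mod_cast Fintype.card_pos))
  rw [@avg_const B _ ⟨b0⟩] at h2
  linarith

lemma chernoff {Z : Type} [Fintype Z] {P r : Z → ℝ} (hP : IsPMF P)
    (hr : ∀ z, P z ≠ 0 → 0 < r z) {I0 : ℝ} (hI : I0 < ∑ z, P z * Real.logb 2 (r z)) :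
    ∃ ρ : ℝ, 0 ≤ ρ ∧ ρ < 1 ∧ ∀ N : ℕ, ∑ z : Fin N → Z, (∏ t, P (z t)) *
      (if ∏ t, r (z t) ≤ (2:ℝ) ^ (N * I0) then 1 else 0) ≤ ρ ^ N := by
  have hl := Real.log_pos (by norm_num : (1:ℝ) < 2)
  set a : Z → ℝ := fun z => I0 * Real.log 2 - Real.log (r z) with ha
  set psi : ℝ → ℝ := fun s => ∑ z, P z * Real.exp (s * a z) with hpsi
  have hd : HasDerivAt psi (∑ z, P z * (Real.exp (0 * a z) * (1 * a z))) 0 := by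
    apply HasDerivAt.fun_sum
    intro z _
    exact (((hasDerivAt_id (0:ℝ)).mul_const (a z)).exp).const_mul (P z)
  have hneg : ∑ z, P z * (Real.exp (0 * a z) * (1 * a z)) < 0 := by
    have e1 : ∑ z, P z * (Real.exp (0 * a z) * (1 * a z))
        = Real.log 2 * (I0 - ∑ z, P z * Real.logb 2 (r z)) := by
      have : ∀ z, P z * (Real.exp (0 * a z) * (1 * a z))
          = Real.log 2 * I0 * P z - Real.log 2 * (P z * Real.logb 2 (r z)) := by
        intro z
        simp only [ha, zero_mul, Real.exp_zero, Real.logb]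
        field_simp
      simp only [this, sum_sub_distrib, ← mul_sum, hP.2]
      ring
    rw [e1]
    nlinarith
  have hex : ∃ s > 0, psi s < 1 := by
    have h1 := (hasDerivAt_iff_tendsto_slope.1 hd).eventually_lt_const hneg
    have h2 : ∀ᶠ s in nhdsWithin (0:ℝ) (Set.Ioi 0), slope psi 0 s < 0 :=
      h1.filter_mono (nhdsWithin_mono _ fun x hx => ne_of_gt hx)
    obtain ⟨s, hs, hs0⟩ := (h2.and self_mem_nhdsWithin).exists
    refine ⟨s, hs0, ?_⟩
    rw [slope_def_field] at hs
    have hs0' : (0:ℝ) < s := hs0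
    have p0 : psi 0 = 1 := by simp [hpsi, hP.2]
    rw [p0, sub_zero, div_lt_iff₀ hs0', zero_mul] at hs
    linarith
  obtain ⟨s, hs0, hs⟩ := hex
  refine ⟨psi s, sum_nonneg fun z _ => mul_nonneg (hP.1 z) (Real.exp_pos _).le, hs, fun N => ?_⟩
  have e2 : psi s ^ N = ∑ z : Fin N → Z, ∏ t, P (z t) * Real.exp (s * a (z t)) := by
    rw [← Fintype.prod_sum (fun (_ : Fin N) z => P z * Real.exp (s * a z))]
    simp [hpsi]
  rw [e2]
  refine sum_le_sum fun z _ => ?_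
  rw [prod_mul_distrib]
  by_cases h0 : ∏ t, P (z t) = 0
  · simp [h0]
  refine mul_le_mul_of_nonneg_left ?_ (prod_nonneg fun t _ => hP.1 _)
  rw [← Real.exp_sum]
  split_ifs with hc
  · rw [Real.one_le_exp_iff]
    have hpos : ∀ t, 0 < r (z t) := fun t => hr _ (prod_ne_zero_iff.1 h0 t (mem_univ _))
    have h3 := Real.log_le_log (prod_pos fun t _ => hpos t) hc
    rw [Real.log_prod (fun t _ => (hpos t).ne'), Real.log_rpow (by norm_num)] at h3
    rw [← mul_sum]
    refine mul_nonneg hs0.le ?_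
    simp only [ha, sum_sub_distrib, sum_const, card_univ, Fintype.card_fin, nsmul_eq_mul]
    linarith
  · positivity

/-- output distribution under uniform input -/
def qU {A Y : Type} [Fintype A] (V : A → Y → ℝ) (y : Y) : ℝ := avg (fun a => V a y)

/-- mutual information under uniform input -/
def Iu {A Y : Type} [Fintype A] [Fintype Y] (V : A → Y → ℝ) : ℝ :=
  Hent (qU V) - avg (fun a => Hent (V a))

lemma qU_nonneg {A Y : Type} [Fintype A] [Fintype Y] {V : A → Y → ℝ} (hV : IsChannel V) (y : Y) :
    0 ≤ qU V y := avg_nonneg fun a => (hV a).1 y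

lemma qU_pos {A Y : Type} [Fintype A] [Fintype Y] {V : A → Y → ℝ} (hV : IsChannel V) {a : A} {y : Y}
    (h : V a y ≠ 0) : 0 < qU V y := by
  have : Nonempty A := ⟨a⟩
  have h1 : 0 < V a y := lt_of_le_of_ne ((hV a).1 y) h.symm
  refine mul_pos (inv_pos.2 (by exact_mod_cast Fintype.card_pos)) ?_
  exact lt_of_lt_of_le h1 (single_le_sum (f := fun a => V a y) (fun a _ => (hV a).1 y) (mem_univ a))

lemma Iu_eq {A Y : Type} [Fintype A] [Fintype Y] {V : A → Y → ℝ} (hV : IsChannel V) :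
    Iu V = ∑ z : A × Y, (((Fintype.card A : ℕ) : ℝ)⁻¹ * V z.1 z.2) *
      Real.logb 2 (V z.1 z.2 / qU V z.2) := by
  have h1 : ∀ z : A × Y, (((Fintype.card A : ℕ) : ℝ)⁻¹ * V z.1 z.2) *
      Real.logb 2 (V z.1 z.2 / qU V z.2) =
      ((Fintype.card A : ℕ) : ℝ)⁻¹ * (V z.1 z.2 * Real.logb 2 (V z.1 z.2)) -
      (((Fintype.card A : ℕ) : ℝ)⁻¹ * V z.1 z.2) * Real.logb 2 (qU V z.2) := by
    intro z
    by_cases h : V z.1 z.2 = 0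
    · simp [h]
    rw [Real.logb_div h (qU_pos hV h).ne']; ring
  simp only [h1, sum_sub_distrib]
  have h2 : ∑ z : A × Y, (((Fintype.card A : ℕ) : ℝ)⁻¹ * V z.1 z.2) * Real.logb 2 (qU V z.2)
      = - Hent (qU V) := by
    unfold Hent
    rw [neg_neg, Fintype.sum_prod_type_right]
    refine sum_congr rfl fun y _ => ?_
    change ∑ x, (((Fintype.card A : ℕ) : ℝ)⁻¹ * V x y) * Real.logb 2 (qU V y) = _
    rw [← sum_mul, ← mul_sum]
    rfl
  have h3 : ∑ z : A × Y, ((Fintype.card A : ℕ) : ℝ)⁻¹ * (V z.1 z.2 * Real.logb 2 (V z.1 z.2))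
      = - avg (fun a => Hent (V a)) := by
    unfold avg Hent
    rw [Fintype.sum_prod_type, sum_neg_distrib, mul_neg, neg_neg, mul_sum]
    refine sum_congr rfl fun a _ => ?_
    rw [mul_sum]
  rw [h2, h3]
  unfold Iu
  ring

/-- threshold decoder -/
def tdec {M A Y : Type} [Nonempty M] (V : A → Y → ℝ) (q : Y → ℝ) (τ : ℝ) (c : M → A) (y : Y) : M :=
  if h : ∃ i, τ * q y < V (c i) y then h.choose else Classical.arbitrary M

lemma tdec_err {M A Y : Type} [Fintype M] [DecidableEq M] [Nonempty M] (V : A → Y → ℝ) (q : Y → ℝ)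
    (τ : ℝ) (c : M → A) (y : Y) (i : M) :
    (if tdec V q τ c y = i then (0:ℝ) else 1) ≤ (if V (c i) y ≤ τ * q y then 1 else 0)
      + ∑ j ∈ univ.erase i, (if τ * q y < V (c j) y then 1 else 0) := by
  have hs : 0 ≤ ∑ j ∈ univ.erase i, (if τ * q y < V (c j) y then (1:ℝ) else 0) :=
    sum_nonneg fun j _ => by split_ifs <;> norm_num
  by_cases h1 : V (c i) y ≤ τ * q y
  · rw [if_pos h1]
    split_ifs <;> linarith
  rw [if_neg h1]
  by_cases h2 : tdec V q τ c y = i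
  · rw [if_pos h2]; linarith
  rw [if_neg h2, zero_add]
  have hex : ∃ i, τ * q y < V (c i) y := ⟨i, not_le.1 h1⟩
  have h3 : τ * q y < V (c (tdec V q τ c y)) y := by
    unfold tdec
    rw [dif_pos hex]; exact hex.choose_spec
  have := single_le_sum (f := fun j => if τ * q y < V (c j) y then (1:ℝ) else 0)
    (fun j _ => by split_ifs <;> norm_num) (mem_erase.2 ⟨h2, mem_univ (tdec V q τ c y)⟩)
  rw [if_pos h3] at this
  exact this

lemma one_shot {M A Y : Type} [Fintype M] [DecidableEq M] [Nonempty M] [Fintype A] [Nonempty A]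
    [Fintype Y] {V : A → Y → ℝ} (hV : IsChannel V) {τ : ℝ} (hτ : 0 < τ) (i : M) :
    avg (fun c : M → A => ∑ y, V (c i) y * (if tdec V (qU V) τ c y = i then 0 else 1)) ≤
      avg (fun a => ∑ y, V a y * (if V a y ≤ τ * qU V y then 1 else 0))
        + (((Fintype.card M : ℕ) : ℝ) - 1) / τ := by
  have h1 : ∀ c : M → A, ∑ y, V (c i) y * (if tdec V (qU V) τ c y = i then 0 else 1) ≤
      ∑ y, V (c i) y * (if V (c i) y ≤ τ * qU V y then 1 else 0) +
      ∑ j ∈ univ.erase i, ∑ y, V (c i) y * (if τ * qU V y < V (c j) y then 1 else 0) := by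
    intro c
    rw [sum_comm, ← sum_add_distrib]
    refine sum_le_sum fun y _ => ?_
    rw [← mul_sum, ← mul_add]
    exact mul_le_mul_of_nonneg_left (tdec_err V (qU V) τ c y i) ((hV _).1 y)
  refine (avg_mono h1).trans ?_
  rw [avg_add]
  refine add_le_add (le_of_eq ?_) ?_
  · exact avg_coord i (fun a => ∑ y, V a y * (if V a y ≤ τ * qU V y then 1 else 0))
  · have h2 : ∀ j ∈ univ.erase i, avg (fun c : M → A => ∑ y, V (c i) y *
        (if τ * qU V y < V (c j) y then 1 else 0)) ≤ 1 / τ := by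
      intro j hj
      rw [avg_coord2 (ne_of_mem_erase hj)
        (fun a b => ∑ y, V a y * (if τ * qU V y < V b y then 1 else 0)), avg_comm]
      have h3 : ∀ b : A, avg (fun a => ∑ y, V a y * (if τ * qU V y < V b y then (1:ℝ) else 0))
          ≤ 1 / τ := by
        intro b
        rw [avg_sum]
        have : ∀ y, avg (fun a => V a y * (if τ * qU V y < V b y then (1:ℝ) else 0))
            ≤ V b y / τ := by
          intro y
          rw [avg_mul_right]
          change qU V y * _ ≤ _
          split_ifs with h
          · rw [mul_one, le_div_iff₀ hτ]; linarith
          · rw [mul_zero]; exact div_nonneg ((hV b).1 y) hτ.le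
        refine (sum_le_sum fun y _ => this y).trans ?_
        rw [← sum_div, (hV b).2]
      refine (avg_mono h3).trans ?_
      rw [avg_const]
    rw [avg_sum]
    refine (sum_le_sum h2).trans ?_
    rw [sum_const, card_erase_of_mem (mem_univ i), card_univ, nsmul_eq_mul,
      Nat.cast_sub Fintype.card_pos]
    apply le_of_eq
    push_cast
    ring

lemma qU_nF {A Y : Type} [Fintype A] (V : A → Y → ℝ) (N : ℕ) (y : Fin N → Y) :
    qU (nF (ι := Fin N) V) y = ∏ t, qU V (y t) := by
  unfold qU nF
  rw [avg_pi (fun t a => V a (y t))]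

/-- i.i.d. random coding: decoder -/
def rdec {M A Y : Type} [Nonempty M] [Fintype A] (V : A → Y → ℝ) (I0 : ℝ) (N : ℕ)
    (c : M → Fin N → A) (y : Fin N → Y) : M :=
  tdec (nF V) (qU (nF V)) ((2:ℝ) ^ (N * I0)) c y

lemma random_coding {A Y : Type} [Fintype A] [Nonempty A] [Fintype Y] {V : A → Y → ℝ}
    (hV : IsChannel V) {I0 : ℝ} (hI : I0 < Iu V) :
    ∃ ρ : ℝ, 0 ≤ ρ ∧ ρ < 1 ∧ ∀ (N : ℕ) (M : Type) [Fintype M] [DecidableEq M] [Nonempty M] (i : M),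
      avg (fun c : M → Fin N → A => ∑ y, nF V (c i) y * (if rdec V I0 N c y = i then 0 else 1))
        ≤ ρ ^ N + (((Fintype.card M : ℕ) : ℝ) - 1) * (2:ℝ) ^ (-(N * I0)) := by
  have hca : (0:ℝ) < ((Fintype.card A : ℕ) : ℝ) := by exact_mod_cast Fintype.card_pos
  have hP : IsPMF (fun z : A × Y => ((Fintype.card A : ℕ) : ℝ)⁻¹ * V z.1 z.2) := by
    refine ⟨fun z => mul_nonneg (by positivity) ((hV _).1 _), ?_⟩
    rw [← mul_sum, Fintype.sum_prod_type]
    simp only [(hV _).2]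
    simp
  rw [Iu_eq hV] at hI
  obtain ⟨ρ, h0, h1, hN⟩ := chernoff hP (r := fun z => V z.1 z.2 / qU V z.2) (by
    intro z hz
    have hz' : V z.1 z.2 ≠ 0 := right_ne_zero_of_mul hz
    exact div_pos (lt_of_le_of_ne ((hV _).1 _) hz'.symm) (qU_pos hV hz')) hI
  refine ⟨ρ, h0, h1, ?_⟩
  intro N M _ _ _ i
  have hτ : (0:ℝ) < (2:ℝ) ^ (N * I0) := by positivity
  refine (one_shot (nF_channel hV) hτ i).trans ?_
  rw [Real.rpow_neg (by norm_num), div_eq_mul_inv]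
  refine add_le_add ?_ le_rfl
  refine le_trans ?_ (hN N)
  rw [← Equiv.sum_comp (Equiv.arrowProdEquivProdArrow (Fin N) (fun _ => A) (fun _ => Y)).symm,
    Fintype.sum_prod_type]
  unfold avg
  rw [mul_sum]
  refine sum_le_sum fun a _ => ?_
  rw [mul_sum]
  refine sum_le_sum fun y _ => ?_
  simp only [Equiv.arrowProdEquivProdArrow_symm_apply]
  rw [prod_mul_distrib, prod_const, card_univ, Fintype.card_fin, Fintype.card_pi_const]
  push_cast
  rw [inv_pow, mul_assoc]
  refine mul_le_mul_of_nonneg_left ?_ (by positivity)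
  by_cases hz : nF V a y = 0
  · have : ∏ t, V (a t) (y t) = 0 := hz
    rw [hz, this, zero_mul, zero_mul]
  refine mul_le_mul_of_nonneg_left ?_ (prod_nonneg fun t _ => (hV _).1 _)
  rw [prod_div_distrib, qU_nF]
  have hq : 0 < ∏ t, qU V (y t) := prod_pos fun t _ =>
    qU_pos hV (prod_ne_zero_iff.1 hz t (mem_univ _))
  have hiff := div_le_iff₀ (a := (2:ℝ) ^ (N * I0)) (b := nF V a y) hq
  by_cases h : nF V a y ≤ (2:ℝ) ^ (N * I0) * ∏ t, qU V (y t)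
  · rw [if_pos h]
    exact (if_pos (hiff.2 h)).ge
  · rw [if_neg h]
    split_ifs <;> norm_num


section Marg
variable {X Y1 Y2 : Type} [Fintype Y1] [Fintype Y2]

lemma margW1_channel {W : X → Y1 × Y2 → ℝ} (hW : IsChannel W) : IsChannel (margW1 W) := by
  intro x
  refine ⟨fun y => sum_nonneg fun y2 _ => (hW x).1 _, ?_⟩
  unfold margW1
  rw [← (hW x).2, Fintype.sum_prod_type]

lemma margW2_channel {W : X → Y1 × Y2 → ℝ} (hW : IsChannel W) : IsChannel (margW2 W) := by
  intro x
  refine ⟨fun y => sum_nonneg fun y2 _ => (hW x).1 _, ?_⟩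
  unfold margW2
  rw [← (hW x).2, Fintype.sum_prod_type_right]

lemma nFold_marg1 (W : X → Y1 × Y2 → ℝ) (n : ℕ) (x : Fin n → X) (φ : (Fin n → Y1) → ℝ) :
    ∑ y : (Fin n → Y1) × (Fin n → Y2), nFold W n x y * φ y.1
      = ∑ y1, nF (margW1 W) x y1 * φ y1 := by
  rw [Fintype.sum_prod_type]
  refine sum_congr rfl fun y1 _ => ?_
  change ∑ y2, nFold W n x (y1, y2) * φ y1 = _
  rw [← sum_mul]
  congr 1
  unfold nFold nF margW1
  rw [Fintype.prod_sum]

lemma nFold_marg2 (W : X → Y1 × Y2 → ℝ) (n : ℕ) (x : Fin n → X) (φ : (Fin n → Y2) → ℝ) :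
    ∑ y : (Fin n → Y1) × (Fin n → Y2), nFold W n x y * φ y.2
      = ∑ y2, nF (margW2 W) x y2 * φ y2 := by
  rw [Fintype.sum_prod_type_right]
  refine sum_congr rfl fun y1 _ => ?_
  change ∑ y2, nFold W n x (y2, y1) * φ y1 = _
  rw [← sum_mul]
  congr 1
  unfold nFold nF margW2
  rw [Fintype.prod_sum]

lemma nFold_nonneg {W : X → Y1 × Y2 → ℝ} (hW : IsChannel W) (n : ℕ) (x : Fin n → X)
    (y : (Fin n → Y1) × (Fin n → Y2)) : 0 ≤ nFold W n x y :=
  prod_nonneg fun t _ => (hW _).1 _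

lemma ind_le (A B : Prop) :
    (if A ∧ B then (0:ℝ) else 1) ≤ (if A then 0 else 1) + (if B then 0 else 1) := by
  by_cases hA : A <;> by_cases hB : B <;> simp [hA, hB]

lemma ind_ge1 (A B : Prop) :
    (if A then (0:ℝ) else 1) ≤ (if A ∧ B then 0 else 1) := by
  by_cases hA : A <;> by_cases hB : B <;> simp [hA, hB]

lemma ind_ge2 (A B : Prop) :
    (if B then (0:ℝ) else 1) ≤ (if A ∧ B then 0 else 1) := by
  by_cases hA : A <;> by_cases hB : B <;> simp [hA, hB]

lemma errP0_le {W : X → Y1 × Y2 → ℝ} (hW : IsChannel W) (n k1 k2 : ℕ)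
    (f : Fin k1 × Fin k2 → Fin n → X)
    (g1 : (Fin n → Y1) → Fin k1) (g2 : (Fin n → Y2) → Fin k2) :
    errP0 W n k1 k2 f g1 g2 ≤ avg (fun m : Fin k1 × Fin k2 =>
      ∑ y1, nF (margW1 W) (f m) y1 * (if g1 y1 = m.1 then 0 else 1)
      + ∑ y2, nF (margW2 W) (f m) y2 * (if g2 y2 = m.2 then 0 else 1)) := by
  unfold errP0 avg
  simp only [Fintype.card_prod, Fintype.card_fin, Nat.cast_mul, one_div]
  refine mul_le_mul_of_nonneg_left (sum_le_sum fun m _ => ?_) (by positivity)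
  rw [← nFold_marg1 W n (f m) (fun y1 => if g1 y1 = m.1 then 0 else 1),
    ← nFold_marg2 W n (f m) (fun y2 => if g2 y2 = m.2 then 0 else 1), ← sum_add_distrib]
  refine sum_le_sum fun y _ => ?_
  rw [← mul_add]
  refine mul_le_mul_of_nonneg_left ?_ (nFold_nonneg hW n _ _)
  by_cases hA : g1 y.1 = m.1 <;> by_cases hB : g2 y.2 = m.2 <;> simp [hA, hB]

lemma errP1_le {W : X → Y1 × Y2 → ℝ} (hW : IsChannel W) (n k1 k2 : ℕ)
    (f : Fin k1 × Fin k2 → Fin n → X)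
    (g1 : (Fin n → Y1) × Fin k2 → Fin k1) (g2 : (Fin n → Y2) → Fin k2) :
    errP1 W n k1 k2 f g1 g2 ≤ avg (fun m : Fin k1 × Fin k2 =>
      ∑ y1, nF (margW1 W) (f m) y1 * (if g1 (y1, m.2) = m.1 then 0 else 1)
      + ∑ y2, nF (margW2 W) (f m) y2 * (if g2 y2 = m.2 then 0 else 1)) := by
  unfold errP1 avg
  simp only [Fintype.card_prod, Fintype.card_fin, Nat.cast_mul, one_div]
  refine mul_le_mul_of_nonneg_left (sum_le_sum fun m _ => ?_) (by positivity)
  rw [← nFold_marg1 W n (f m) (fun y1 => if g1 (y1, m.2) = m.1 then 0 else 1),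
    ← nFold_marg2 W n (f m) (fun y2 => if g2 y2 = m.2 then 0 else 1), ← sum_add_distrib]
  refine sum_le_sum fun y _ => ?_
  rw [← mul_add]
  refine mul_le_mul_of_nonneg_left ?_ (nFold_nonneg hW n _ _)
  by_cases hA : g1 (y.1, m.2) = m.1 <;> by_cases hB : g2 y.2 = m.2 <;> simp [hA, hB]

lemma errP1_ge1 {W : X → Y1 × Y2 → ℝ} (hW : IsChannel W) (n k1 k2 : ℕ)
    (f : Fin k1 × Fin k2 → Fin n → X)
    (g1 : (Fin n → Y1) × Fin k2 → Fin k1) (g2 : (Fin n → Y2) → Fin k2) :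
    avg (fun m : Fin k1 × Fin k2 =>
      ∑ y1, nF (margW1 W) (f m) y1 * (if g1 (y1, m.2) = m.1 then 0 else 1))
      ≤ errP1 W n k1 k2 f g1 g2 := by
  unfold errP1 avg
  simp only [Fintype.card_prod, Fintype.card_fin, Nat.cast_mul, one_div]
  refine mul_le_mul_of_nonneg_left (sum_le_sum fun m _ => ?_) (by positivity)
  rw [← nFold_marg1 W n (f m) (fun y1 => if g1 (y1, m.2) = m.1 then 0 else 1)]
  refine sum_le_sum fun y _ => ?_
  refine mul_le_mul_of_nonneg_left ?_ (nFold_nonneg hW n _ _)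
  by_cases hA : g1 (y.1, m.2) = m.1 <;> by_cases hB : g2 y.2 = m.2 <;> simp [hA, hB]

lemma errP1_ge2 {W : X → Y1 × Y2 → ℝ} (hW : IsChannel W) (n k1 k2 : ℕ)
    (f : Fin k1 × Fin k2 → Fin n → X)
    (g1 : (Fin n → Y1) × Fin k2 → Fin k1) (g2 : (Fin n → Y2) → Fin k2) :
    avg (fun m : Fin k1 × Fin k2 =>
      ∑ y2, nF (margW2 W) (f m) y2 * (if g2 y2 = m.2 then 0 else 1))
      ≤ errP1 W n k1 k2 f g1 g2 := by
  unfold errP1 avg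
  simp only [Fintype.card_prod, Fintype.card_fin, Nat.cast_mul, one_div]
  refine mul_le_mul_of_nonneg_left (sum_le_sum fun m _ => ?_) (by positivity)
  rw [← nFold_marg2 W n (f m) (fun y2 => if g2 y2 = m.2 then 0 else 1)]
  refine sum_le_sum fun y _ => ?_
  refine mul_le_mul_of_nonneg_left ?_ (nFold_nonneg hW n _ _)
  by_cases hA : g1 (y.1, m.2) = m.1 <;> by_cases hB : g2 y.2 = m.2 <;> simp [hA, hB]

end Marg

/-- flattening of blocks -/
def flatE (N n : ℕ) (Y : Type) : (Fin N → Fin n → Y) ≃ (Fin (N * n) → Y) :=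
  (Equiv.curry (Fin N) (Fin n) Y).symm.trans (Equiv.arrowCongr finProdFinEquiv (Equiv.refl Y))

lemma nF_flat {X Y : Type} (W : X → Y → ℝ) (N n : ℕ) (x : Fin N → Fin n → X)
    (y : Fin N → Fin n → Y) :
    nF W (flatE N n X x) (flatE N n Y y) = ∏ t, nF W (x t) (y t) := by
  unfold nF
  rw [← Equiv.prod_comp finProdFinEquiv, Fintype.prod_prod_type]
  simp [flatE]

/-- message size for rate `r` at block length `N` -/
def Ksz (r : ℝ) (N : ℕ) : ℕ := ⌈(2:ℝ) ^ (N * r)⌉₊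

lemma Ksz_pos (r : ℝ) (N : ℕ) : 0 < Ksz r N := Nat.ceil_pos.2 (by positivity)

lemma Ksz_zero (N : ℕ) : Ksz 0 N = 1 := by simp [Ksz]

lemma Ksz_log (r : ℝ) (N : ℕ) : N * r ≤ Real.logb 2 (Ksz r N) := by
  rw [Real.le_logb_iff_rpow_le (by norm_num) (by exact_mod_cast Ksz_pos r N)]
  exact Nat.le_ceil _

lemma Ksz_le {r : ℝ} (hr : 0 ≤ r) (N : ℕ) : (Ksz r N : ℝ) ≤ 2 * (2:ℝ) ^ (N * r) := by
  have h1 : (Ksz r N : ℝ) < (2:ℝ) ^ (N * r) + 1 := Nat.ceil_lt_add_one (by positivity)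
  have h2 : (1:ℝ) ≤ (2:ℝ) ^ (N * r) := Real.one_le_rpow (by norm_num) (by positivity)
  linarith

lemma Ksz_tendsto {r1 r2 I : ℝ} (h1 : 0 ≤ r1) (h2 : 0 ≤ r2)
    (h : (r1 = 0 ∧ r2 = 0) ∨ r1 + r2 < I) :
    ∃ I0 < I, Filter.Tendsto (fun N : ℕ => ((Ksz r1 N : ℝ) * (Ksz r2 N : ℝ) - 1) *
      (2:ℝ) ^ (-(N * I0))) Filter.atTop (nhds 0) := by
  rcases h with ⟨rfl, rfl⟩ | h
  · refine ⟨I - 1, by linarith, ?_⟩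
    simp [Ksz_zero]
  · refine ⟨(r1 + r2 + I) / 2, by linarith, ?_⟩
    set d := (I - (r1 + r2)) / 2 with hd
    have hd0 : 0 < d := by rw [hd]; linarith
    have ht : Filter.Tendsto (fun N : ℕ => 4 * ((2:ℝ) ^ (-d)) ^ N) Filter.atTop (nhds (4 * 0)) := by
      refine (tendsto_pow_atTop_nhds_zero_of_lt_one (by positivity) ?_).const_mul 4
      exact Real.rpow_lt_one_of_one_lt_of_neg (by norm_num) (by linarith)
    rw [mul_zero] at ht
    refine squeeze_zero (fun N => ?_) (fun N => ?_) ht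
    · have a1 : (1:ℝ) ≤ Ksz r1 N := by exact_mod_cast Ksz_pos r1 N
      have a2 : (1:ℝ) ≤ Ksz r2 N := by exact_mod_cast Ksz_pos r2 N
      exact mul_nonneg (by nlinarith) (by positivity)
    · have a1 := Ksz_le h1 N
      have a2 := Ksz_le h2 N
      have a3 : (Ksz r1 N : ℝ) * Ksz r2 N ≤ (2 * (2:ℝ) ^ (N * r1)) * (2 * (2:ℝ) ^ (N * r2)) :=
        mul_le_mul a1 a2 (by positivity) (by positivity)
      calc ((Ksz r1 N : ℝ) * (Ksz r2 N : ℝ) - 1) * (2:ℝ) ^ (-((N:ℝ) * ((r1 + r2 + I) / 2)))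
          ≤ ((2 * (2:ℝ) ^ (N * r1)) * (2 * (2:ℝ) ^ (N * r2)))
            * (2:ℝ) ^ (-((N:ℝ) * ((r1 + r2 + I) / 2))) :=
            mul_le_mul_of_nonneg_right (by linarith) (by positivity)
        _ = 4 * ((2:ℝ) ^ (N * r1) * (2:ℝ) ^ (N * r2)
            * (2:ℝ) ^ (-((N:ℝ) * ((r1 + r2 + I) / 2)))) := by ring
        _ = 4 * ((2:ℝ) ^ (-d)) ^ N := by
            rw [← Real.rpow_add (by norm_num), ← Real.rpow_add (by norm_num),
              ← Real.rpow_natCast, ← Real.rpow_mul (by norm_num), hd]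
            congr 2
            ring

lemma Ksz_tendsto1 {r I : ℝ} (h1 : 0 ≤ r) (h : r = 0 ∨ r < I) :
    ∃ I0 < I, Filter.Tendsto (fun N : ℕ => ((Ksz r N : ℝ) - 1) *
      (2:ℝ) ^ (-(N * I0))) Filter.atTop (nhds 0) := by
  obtain ⟨I0, h2, h3⟩ := Ksz_tendsto (r2 := 0) (I := I) h1 le_rfl (by simpa using h)
  refine ⟨I0, h2, ?_⟩
  simpa [Ksz_zero] using h3

/-- Achievability when receiver 2 decodes both messages. -/
lemma achA {X Y1 Y2 : Type} [Fintype X] [Nonempty X] [Fintype Y1] [Fintype Y2]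
    {W : X → Y1 × Y2 → ℝ} (hW : IsChannel W) {r1 r2 : ℝ} (h1 : 0 ≤ r1) (h2 : 0 ≤ r2)
    (hr1 : r1 = 0 ∨ r1 < Iu (margW1 W)) (hr2 : (r1 = 0 ∧ r2 = 0) ∨ r1 + r2 < Iu (margW2 W)) :
    Ach1 W (r1, r2) := by
  refine ⟨h1, h2, fun ε hε => ?_⟩
  obtain ⟨I1, hI1, t1⟩ := Ksz_tendsto1 h1 hr1
  obtain ⟨I2, hI2, t2⟩ := Ksz_tendsto h1 h2 hr2
  obtain ⟨ρ1, hρ10, hρ11, H1⟩ := random_coding (margW1_channel hW) hI1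
  obtain ⟨ρ2, hρ20, hρ21, H2⟩ := random_coding (margW2_channel hW) hI2
  have T := ((tendsto_pow_atTop_nhds_zero_of_lt_one hρ10 hρ11).add t1).add
    ((tendsto_pow_atTop_nhds_zero_of_lt_one hρ20 hρ21).add t2)
  simp only [add_zero] at T
  obtain ⟨N, hN, hN0⟩ := ((T.eventually_le_const hε).and (Filter.eventually_gt_atTop 0)).exists
  set K1 := Ksz r1 N with hK1
  set K2 := Ksz r2 N with hK2
  have hK1p : 0 < K1 := Ksz_pos _ _
  have hK2p : 0 < K2 := Ksz_pos _ _
  have : Nonempty (Fin K1) := ⟨⟨0, hK1p⟩⟩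
  have : Nonempty (Fin K2) := ⟨⟨0, hK2p⟩⟩
  have key : avg (fun c : Fin K2 → Fin K1 → Fin N → X => avg (fun m : Fin K1 × Fin K2 =>
      ∑ y1, nF (margW1 W) (c m.2 m.1) y1 *
        (if rdec (margW1 W) I1 N (c m.2) y1 = m.1 then 0 else 1)
      + ∑ y2, nF (margW2 W) (c m.2 m.1) y2 *
        (if (rdec (margW2 W) I2 N (fun z : Fin K2 × Fin K1 => c z.1 z.2) y2).1 = m.2
          then 0 else 1))) ≤ ε := by
    rw [avg_comm]
    refine le_trans ?_ hN
    rw [← avg_const (B := Fin K1 × Fin K2) (ρ1 ^ N + ((K1:ℝ) - 1) * 2 ^ (-((N:ℝ) * I1))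
      + (ρ2 ^ N + ((K1:ℝ) * (K2:ℝ) - 1) * 2 ^ (-((N:ℝ) * I2))))]
    refine avg_mono fun m => ?_
    rw [avg_add]
    refine add_le_add ?_ ?_
    · have := H1 N (Fin K1) m.1
      rw [Fintype.card_fin] at this
      refine le_trans (le_of_eq ?_) this
      exact avg_coord m.2 (fun c : Fin K1 → Fin N → X => ∑ y1, nF (margW1 W) (c m.1) y1 *
        (if rdec (margW1 W) I1 N c y1 = m.1 then 0 else 1))
    · have := H2 N (Fin K2 × Fin K1) (m.2, m.1)
      rw [Fintype.card_prod, Fintype.card_fin, Fintype.card_fin, Nat.cast_mul,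
        mul_comm (K2:ℝ)] at this
      refine le_trans ?_ this
      rw [← avg_equiv (Equiv.curry (Fin K2) (Fin K1) (Fin N → X)).symm]
      refine avg_mono fun c => sum_le_sum fun y _ => ?_
      refine mul_le_mul_of_nonneg_left ?_ ((nF_channel (margW2_channel hW) _).1 y)
      have e : (fun z : Fin K2 × Fin K1 => c z.1 z.2)
        = (Equiv.curry (Fin K2) (Fin K1) (Fin N → X)).symm c := rfl
      rw [e]
      set d := rdec (margW2 W) I2 N ((Equiv.curry (Fin K2) (Fin K1) (Fin N → X)).symm c) y
      by_cases hd : d = (m.2, m.1)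
      · rw [if_pos (by rw [hd]), if_pos hd]
      · rw [if_neg hd]; split_ifs <;> norm_num
  obtain ⟨c, hc⟩ := exists_le_avg key
  have hNr : (0:ℝ) < N := by exact_mod_cast hN0
  refine ⟨N, K1, K2, hN0, hK1p, hK2p, fun m => c m.2 m.1,
    fun z => rdec (margW1 W) I1 N (c z.2) z.1,
    fun y => (rdec (margW2 W) I2 N (fun z : Fin K2 × Fin K1 => c z.1 z.2) y).1, ?_, ?_, ?_⟩
  · rw [le_div_iff₀ hNr, mul_comm]; exact Ksz_log _ _
  · rw [le_div_iff₀ hNr, mul_comm]; exact Ksz_log _ _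
  · exact (errP1_le hW N K1 K2 _ _ _).trans hc

section Super
variable {U V Y : Type} [Fintype U] [Fintype V] [Fintype Y]

/-- averaged channel from `U`. -/
def chU (T : V → U → Y → ℝ) : U → Y → ℝ := fun u y => avg (fun v => T v u y)

/-- channel from `V` with output `(Y,U)`. -/
def chV (T : V → U → Y → ℝ) : V → Y × U → ℝ :=
  fun v z => ((Fintype.card U : ℕ) : ℝ)⁻¹ * T v z.2 z.1

lemma chU_channel [Nonempty V] {T : V → U → Y → ℝ} (hT : ∀ v, IsChannel (T v)) :
    IsChannel (chU T) := by
  intro u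
  refine ⟨fun y => avg_nonneg fun v => (hT v u).1 y, ?_⟩
  unfold chU
  rw [← avg_sum]
  simp only [(hT _ u).2]
  rw [avg_const]

lemma chV_channel [Nonempty U] {T : V → U → Y → ℝ} (hT : ∀ v, IsChannel (T v)) :
    IsChannel (chV T) := by
  intro v
  refine ⟨fun z => mul_nonneg (by positivity) ((hT v _).1 _), ?_⟩
  unfold chV
  rw [Fintype.sum_prod_type_right, ← avg_const (B := U) (1:ℝ)]
  unfold avg
  rw [mul_sum]
  refine sum_congr rfl fun u _ => ?_
  rw [← (hT v u).2, mul_sum]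

lemma superU [Nonempty V] {M1 : Type} [Fintype M1] [DecidableEq M1] (T : V → U → Y → ℝ)
    (N : ℕ) (i : M1) (u : Fin N → U) (φ : (Fin N → Y) → ℝ) :
    avg (fun v : M1 → Fin N → V => ∑ y, (∏ t, T (v i t) (u t) (y t)) * φ y)
      = ∑ y, nF (chU T) u y * φ y := by
  rw [avg_sum]
  refine sum_congr rfl fun y _ => ?_
  rw [avg_mul_right]
  congr 1
  unfold nF chU
  rw [avg_pi (fun t v => T v (u t) (y t))]
  exact avg_coord i (fun v : Fin N → V => ∏ t, T (v t) (u t) (y t))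

lemma superV [Nonempty U] {M2 : Type} [Fintype M2] [DecidableEq M2] (T : V → U → Y → ℝ)
    (N : ℕ) (j : M2) (v : Fin N → V) (φ : (Fin N → Y × U) → ℝ) :
    avg (fun u : M2 → Fin N → U => ∑ y : Fin N → Y, (∏ t, T (v t) (u j t) (y t)) *
      φ (fun t => (y t, u j t)))
      = ∑ z, nF (chV T) v z * φ z := by
  rw [avg_coord j (fun u : Fin N → U => ∑ y : Fin N → Y, (∏ t, T (v t) (u t) (y t)) *
      φ (fun t => (y t, u t)))]
  rw [← Equiv.sum_comp (Equiv.arrowProdEquivProdArrow (Fin N) (fun _ => Y) (fun _ => U)).symm,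
    Fintype.sum_prod_type_right]
  unfold avg
  rw [mul_sum]
  refine sum_congr rfl fun u _ => ?_
  rw [mul_sum]
  refine sum_congr rfl fun y _ => ?_
  unfold nF chV
  simp only [Equiv.arrowProdEquivProdArrow_symm_apply]
  rw [prod_mul_distrib, prod_const, card_univ, Fintype.card_fin, Fintype.card_pi_const]
  push_cast
  rw [inv_pow, mul_assoc]
  rfl

end Super

/-- Superposition coding with block super-letters. -/
lemma achB {X Y1 Y2 U V : Type} [Fintype X] [Fintype Y1] [Fintype Y2]
    [Fintype U] [Fintype V] [Nonempty U] [Nonempty V]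
    {W : X → Y1 × Y2 → ℝ} (hW : IsChannel W) {n : ℕ} (hn : 0 < n) (F : V → U → Fin n → X)
    {r1 r2 : ℝ} (h1 : 0 ≤ r1) (h2 : 0 ≤ r2)
    (hr1 : r1 = 0 ∨ n * r1 < Iu (chV (fun v u => nF (margW1 W) (F v u))))
    (hr2 : r2 = 0 ∨ n * r2 < Iu (chU (fun v u => nF (margW2 W) (F v u))))
    (hr2' : r2 = 0 ∨ n * r2 < Iu (chU (fun v u => nF (margW1 W) (F v u)))) :
    Ach0 W (r1, r2) := by
  refine ⟨h1, h2, fun ε hε => ?_⟩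
  have hnr : (0:ℝ) < n := by exact_mod_cast hn
  set T1 : V → U → (Fin n → Y1) → ℝ := fun v u => nF (margW1 W) (F v u) with hT1
  set T2 : V → U → (Fin n → Y2) → ℝ := fun v u => nF (margW2 W) (F v u) with hT2
  have cT1 : ∀ v, IsChannel (T1 v) := fun v u => nF_channel (margW1_channel hW) _
  have cT2 : ∀ v, IsChannel (T2 v) := fun v u => nF_channel (margW2_channel hW) _
  have z1 : 0 ≤ n * r1 := by positivity
  have z2 : 0 ≤ n * r2 := by positivity
  have imp : ∀ {r I : ℝ}, r = 0 ∨ n * r < I → n * r = 0 ∨ n * r < I := by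
    rintro r I (h | h)
    · left; rw [h, mul_zero]
    · right; exact h
  obtain ⟨Ib, hIb, tb⟩ := Ksz_tendsto1 z1 (imp hr1)
  obtain ⟨I2, hI2, t2⟩ := Ksz_tendsto1 z2 (imp hr2)
  obtain ⟨Ia, hIa, ta⟩ := Ksz_tendsto1 z2 (imp hr2')
  obtain ⟨ρb, hρb0, hρb1, Hb⟩ := random_coding (chV_channel cT1) hIb
  obtain ⟨ρ2, hρ20, hρ21, H2⟩ := random_coding (chU_channel cT2) hI2
  obtain ⟨ρa, hρa0, hρa1, Ha⟩ := random_coding (chU_channel cT1) hIa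
  have T := (((tendsto_pow_atTop_nhds_zero_of_lt_one hρa0 hρa1).add ta).add
    ((tendsto_pow_atTop_nhds_zero_of_lt_one hρb0 hρb1).add tb)).add
    ((tendsto_pow_atTop_nhds_zero_of_lt_one hρ20 hρ21).add t2)
  simp only [add_zero] at T
  obtain ⟨N, hN, hN0⟩ := ((T.eventually_le_const hε).and (Filter.eventually_gt_atTop 0)).exists
  set K1 := Ksz (n * r1) N with hK1
  set K2 := Ksz (n * r2) N with hK2
  have hK1p : 0 < K1 := Ksz_pos _ _
  have hK2p : 0 < K2 := Ksz_pos _ _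
  have : Nonempty (Fin K1) := ⟨⟨0, hK1p⟩⟩
  have : Nonempty (Fin K2) := ⟨⟨0, hK2p⟩⟩
  set G1 : (Fin K2 → Fin N → U) → (Fin K1 → Fin N → V) → (Fin N → Fin n → Y1) → Fin K1 :=
    fun u v y => rdec (chV T1) Ib N v (fun t => (y t, u (rdec (chU T1) Ia N u y) t)) with hG1
  set G2 : (Fin K2 → Fin N → U) → (Fin N → Fin n → Y2) → Fin K2 :=
    fun u y => rdec (chU T2) I2 N u y with hG2
  have key : avg (fun u : Fin K2 → Fin N → U => avg (fun v : Fin K1 → Fin N → V =>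
      avg (fun m : Fin K1 × Fin K2 =>
      ∑ y, (∏ t, T1 (v m.1 t) (u m.2 t) (y t)) * (if G1 u v y = m.1 then 0 else 1)
      + ∑ y, (∏ t, T2 (v m.1 t) (u m.2 t) (y t)) * (if G2 u y = m.2 then 0 else 1)))) ≤ ε := by
    have sw : ∀ u : Fin K2 → Fin N → U, avg (fun v : Fin K1 → Fin N → V =>
      avg (fun m : Fin K1 × Fin K2 =>
      ∑ y, (∏ t, T1 (v m.1 t) (u m.2 t) (y t)) * (if G1 u v y = m.1 then 0 else 1)
      + ∑ y, (∏ t, T2 (v m.1 t) (u m.2 t) (y t)) * (if G2 u y = m.2 then 0 else 1)))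
      = avg (fun m : Fin K1 × Fin K2 => avg (fun v : Fin K1 → Fin N → V =>
      ∑ y, (∏ t, T1 (v m.1 t) (u m.2 t) (y t)) * (if G1 u v y = m.1 then 0 else 1)
      + ∑ y, (∏ t, T2 (v m.1 t) (u m.2 t) (y t)) * (if G2 u y = m.2 then 0 else 1))) :=
      fun u => avg_comm _
    simp only [sw]
    rw [avg_comm]
    refine le_trans ?_ hN
    rw [← avg_const (B := Fin K1 × Fin K2) (ρa ^ N + ((K2:ℝ) - 1) * 2 ^ (-((N:ℝ) * Ia))
      + (ρb ^ N + ((K1:ℝ) - 1) * 2 ^ (-((N:ℝ) * Ib)))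
      + (ρ2 ^ N + ((K2:ℝ) - 1) * 2 ^ (-((N:ℝ) * I2))))]
    refine avg_mono fun m => ?_
    simp only [avg_add]
    refine add_le_add ?_ ?_
    · have hb1 : ∀ (u : Fin K2 → Fin N → U) (v : Fin K1 → Fin N → V),
          ∑ y : Fin N → Fin n → Y1, (∏ t, T1 (v m.1 t) (u m.2 t) (y t)) * (if G1 u v y = m.1 then 0 else 1)
          ≤ ∑ y : Fin N → Fin n → Y1, (∏ t, T1 (v m.1 t) (u m.2 t) (y t)) *
              (if rdec (chU T1) Ia N u y = m.2 then 0 else 1)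
            + ∑ y : Fin N → Fin n → Y1, (∏ t, T1 (v m.1 t) (u m.2 t) (y t)) *
              (if rdec (chV T1) Ib N v (fun t => (y t, u m.2 t)) = m.1 then 0 else 1) := by
        intro u v
        rw [← sum_add_distrib]
        refine sum_le_sum fun y _ => ?_
        rw [← mul_add]
        refine mul_le_mul_of_nonneg_left ?_ (prod_nonneg fun t _ => (cT1 _ _).1 _)
        by_cases hd : rdec (chU T1) Ia N u y = m.2
        · rw [if_pos hd, zero_add]
          simp only [hG1]
          rw [hd]
        · rw [if_neg hd]
          split_ifs <;> norm_num
      refine (avg_mono fun u => avg_mono fun v => hb1 u v).trans ?_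
      simp only [avg_add]
      refine add_le_add ?_ ?_
      · have := Ha N (Fin K2) m.2
        rw [Fintype.card_fin] at this
        refine le_trans (le_of_eq ?_) this
        congr 1
        funext u
        exact superU T1 N m.1 (u m.2) (fun y => if rdec (chU T1) Ia N u y = m.2 then 0 else 1)
      · have := Hb N (Fin K1) m.1
        rw [Fintype.card_fin] at this
        refine le_trans (le_of_eq ?_) this
        rw [avg_comm]
        congr 1
        funext v
        exact superV T1 N m.2 (v m.1) (fun z => if rdec (chV T1) Ib N v z = m.1 then 0 else 1)
    · have := H2 N (Fin K2) m.2
      rw [Fintype.card_fin] at this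
      refine le_trans (le_of_eq ?_) this
      congr 1
      funext u
      exact superU T2 N m.1 (u m.2) (fun y => if rdec (chU T2) I2 N u y = m.2 then 0 else 1)
  obtain ⟨u, hu⟩ := exists_le_avg key
  obtain ⟨v, hv⟩ := exists_le_avg hu
  have hNr : (0:ℝ) < N := by exact_mod_cast hN0
  have hL : (0:ℝ) < ((N * n : ℕ) : ℝ) := by push_cast; positivity
  refine ⟨N * n, K1, K2, Nat.mul_pos hN0 hn, hK1p, hK2p,
    fun m => flatE N n X (fun t => F (v m.1 t) (u m.2 t)),
    fun y => G1 u v ((flatE N n Y1).symm y),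
    fun y => G2 u ((flatE N n Y2).symm y), ?_, ?_, ?_⟩
  · rw [le_div_iff₀ hL]
    have := Ksz_log (n * r1) N
    push_cast
    calc r1 * (N * n) = N * (n * r1) := by ring
      _ ≤ _ := this
  · rw [le_div_iff₀ hL]
    have := Ksz_log (n * r2) N
    push_cast
    calc r2 * (N * n) = N * (n * r2) := by ring
      _ ≤ _ := this
  · refine (errP0_le hW (N * n) K1 K2 _ _ _).trans ?_
    refine le_trans (le_of_eq ?_) hv
    congr 1
    funext m
    rw [← Equiv.sum_comp (flatE N n Y1), ← Equiv.sum_comp (flatE N n Y2)]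
    simp only [nF_flat, Equiv.symm_apply_apply, hT1, hT2]


lemma gap_avg {A X Y1 Y2 : Type} [Fintype A] [Nonempty A] [Fintype X] [Fintype Y1] [Fintype Y2]
    {W1 : X → Y1 → ℝ} {W2 : X → Y2 → ℝ} {c : ℝ} (h : EntGap W1 W2 c) (f : A → X) :
    c ≤ Hent (qU fun a => W2 (f a)) - Hent (qU fun a => W1 (f a)) := by
  have e : ∀ {Y : Type} (W : X → Y → ℝ),
      push (fun x => avg (fun a => if f a = x then 1 else 0)) W = qU fun a => W (f a) := by
    intro Y W
    funext y
    unfold push qU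
    simp only [← avg_mul_right]
    rw [← avg_sum]
    congr 1
    funext a
    simp
  have := h (fun x => avg (fun a => if f a = x then 1 else 0))
    (fun x => avg_nonneg fun a => by split_ifs <;> norm_num)
  rw [e, e, ← avg_sum] at this
  have e2 : avg (fun a => ∑ x, (if f a = x then (1:ℝ) else 0)) = 1 := by
    simp [avg_const]
  rw [e2, mul_one] at this
  exact this

lemma Hent_unif {B Y : Type} [Fintype B] [Nonempty B] [Fintype Y] {V : B → Y → ℝ}
    (hV : IsChannel V) :
    Hent (fun z : Y × B => ((Fintype.card B : ℕ) : ℝ)⁻¹ * V z.2 z.1)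
      = avg (fun b => Hent (V b)) + Real.logb 2 ((Fintype.card B : ℕ) : ℝ) := by
  rw [Hent_prod_type]
  simp only [Hent_scale, (hV _).2, one_mul]
  rw [← avg_const (B := B) (Real.logb 2 ((Fintype.card B : ℕ) : ℝ)), ← avg_add]
  unfold avg
  rw [mul_sum]
  refine sum_congr rfl fun b _ => ?_
  rw [Real.logb_inv]
  ring

lemma qU_channel {A Y : Type} [Fintype A] [Nonempty A] [Fintype Y] {V : A → Y → ℝ}
    (hV : IsChannel V) : IsPMF (qU V) := by
  refine ⟨qU_nonneg hV, ?_⟩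
  unfold qU
  rw [← avg_sum]
  simp only [(hV _).2]
  rw [avg_const]

lemma Iu_chV {U V Y : Type} [Fintype U] [Fintype V] [Nonempty U] [Nonempty V] [Fintype Y]
    {T : V → U → Y → ℝ} (hT : ∀ v, IsChannel (T v)) :
    Iu (chV T) = avg (fun u => Hent (qU fun v => T v u))
      - avg (fun v => avg (fun u => Hent (T v u))) := by
  have h1 : qU (chV T) = fun z : Y × U => ((Fintype.card U : ℕ) : ℝ)⁻¹ *
      (fun u => qU fun v => T v u) z.2 z.1 := by
    funext z
    unfold qU chV
    rw [avg_mul_left]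
  have h2 : ∀ v, Hent (chV T v) = avg (fun u => Hent (T v u))
      + Real.logb 2 ((Fintype.card U : ℕ) : ℝ) := fun v => Hent_unif (hT v)
  unfold Iu
  rw [h1, Hent_unif (fun u => qU_channel (fun v => hT v u))]
  simp only [h2]
  rw [avg_add, avg_const]
  ring

lemma fanoU {A B Y : Type} [Fintype A] [DecidableEq A] [Fintype B] [Nonempty A] [Nonempty B] [Fintype Y]
    {V : A → B → Y → ℝ} (hV : ∀ a, IsChannel (V a)) (g : Y × B → A) {l : ℝ} (hl0 : 0 < l)
    (hl1 : l < 1)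
    (herr : avg (fun m : A × B => ∑ y, V m.1 m.2 y * (if g (y, m.2) = m.1 then 0 else 1)) ≤ l) :
    (1 - l) * Real.logb 2 ((Fintype.card A : ℕ) : ℝ) - fanoD l
      ≤ avg (fun b => Hent (qU fun a => V a b)) - avg (fun m : A × B => Hent (V m.1 m.2)) := by
  set J : A × (Y × B) → ℝ := fun z =>
    ((Fintype.card (A × B) : ℕ) : ℝ)⁻¹ * V z.1 z.2.2 z.2.1 with hJd
  have cA : ((Fintype.card A : ℕ) : ℝ) ≠ 0 := by exact_mod_cast Fintype.card_ne_zero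
  have cB : ((Fintype.card B : ℕ) : ℝ) ≠ 0 := by exact_mod_cast Fintype.card_ne_zero
  have hch : IsChannel (fun m : A × B => V m.1 m.2) := fun m => hV _ _
  let e : A × (Y × B) ≃ Y × (A × B) :=
    ⟨fun z => (z.2.1, (z.1, z.2.2)), fun z => (z.2.1, (z.1, z.2.2)), fun _ => rfl, fun _ => rfl⟩
  have hs : ∀ φ : Y × (A × B) → ℝ, ∑ z, J z * φ (e z)
      = avg (fun m : A × B => ∑ y, V m.1 m.2 y * φ (y, m)) := by
    intro φ
    have : ∑ z, J z * φ (e z) = ∑ z : Y × (A × B),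
        ((Fintype.card (A × B) : ℕ) : ℝ)⁻¹ * V z.2.1 z.2.2 z.1 * φ z := by
      rw [← Equiv.sum_comp e]
      rfl
    rw [this, Fintype.sum_prod_type_right]
    unfold avg
    rw [mul_sum]
    refine sum_congr rfl fun m _ => ?_
    rw [mul_sum]
    refine sum_congr rfl fun y _ => ?_
    ring
  have hJ : IsPMF J := by
    refine ⟨fun z => mul_nonneg (by positivity) ((hV _ _).1 _), ?_⟩
    have := hs (fun _ => 1)
    simp only [mul_one, (hV _ _).2] at this
    rw [this, avg_const]
  have herr' : ∑ z, J z * (if g z.2 = z.1 then 0 else 1) ≤ l := by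
    refine le_trans (le_of_eq ?_) herr
    exact hs (fun z => if g (z.1, z.2.2) = z.2.1 then 0 else 1)
  have F := fano J hJ g hl0 hl1 (by
    refine le_trans (le_of_eq ?_) herr'
    congr!)
  have hJ1 : Hent J = avg (fun m : A × B => Hent (V m.1 m.2))
      + Real.logb 2 ((Fintype.card (A × B) : ℕ) : ℝ) := by
    rw [← Hent_unif hch, ← Hent_equiv e]
    rfl
  have hJ2 : (fun z => ∑ m, J (m, z)) = fun z : Y × B => ((Fintype.card B : ℕ) : ℝ)⁻¹ *
      (fun b => qU fun a => V a b) z.2 z.1 := by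
    funext z
    simp only [hJd, qU, avg, Fintype.card_prod, Nat.cast_mul, mul_inv, ← mul_sum]
    ring
  rw [hJ1, hJ2, Hent_unif (fun b => qU_channel (fun a => hV a b)), Fintype.card_prod,
    Nat.cast_mul, Real.logb_mul cA cB] at F
  linarith

lemma fanoD_tendsto : Filter.Tendsto fanoD (nhdsWithin 0 (Set.Ioi 0)) (nhds 0) := by
  have h : Continuous (fun l : ℝ => l * Real.logb 2 l) := by
    have := Real.continuous_mul_log.div_const (Real.log 2)
    refine this.congr fun x => ?_
    simp [Real.logb, mul_div_assoc]
  have h1 : ContinuousAt fanoD 0 := by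
    unfold fanoD
    refine ContinuousAt.sub (ContinuousAt.neg ?_) h.continuousAt
    unfold Real.logb
    refine ContinuousAt.div_const ?_ _
    refine ContinuousAt.log (by fun_prop) (by norm_num)
  have h2 : fanoD 0 = 0 := by simp [fanoD]
  have := h1.tendsto
  rw [h2] at this
  exact this.mono_left nhdsWithin_le_nhds

lemma fanoD_nonneg {l : ℝ} (h0 : 0 < l) (h1 : l < 1) : 0 ≤ fanoD l := by
  unfold fanoD
  have a1 : Real.logb 2 (1 - l) ≤ 0 := Real.logb_nonpos (by norm_num) (by linarith) (by linarith)
  have a2 : Real.logb 2 l ≤ 0 := Real.logb_nonpos (by norm_num) h0.le h1.le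
  nlinarith

/-! channels BSC and BEC -/

lemma BSC_channel {p : ℝ} (h0 : 0 ≤ p) (h1 : p ≤ 1) : IsChannel (BSCk p) := by
  intro x
  refine ⟨fun y => ?_, ?_⟩
  · unfold BSCk; split_ifs <;> linarith
  · cases x <;> simp [BSCk]

lemma BEC_channel {p : ℝ} (h0 : 0 ≤ p) (h1 : p ≤ 1) : IsChannel (BECk p) := by
  intro x
  refine ⟨fun y => ?_, ?_⟩
  · rcases y with _ | y
    · exact h0
    · simp only [BECk]; split_ifs <;> linarith
  · cases x <;> simp [BECk, Fintype.sum_option]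

lemma Hent_push_BSC {p : ℝ} {g : Bool → ℝ} (hg : IsPMF g) :
    Hent (push g (BSCk p)) = Hb (bconv (g true) p) := by
  have h : g false = 1 - g true := by
    have := hg.2
    rw [Fintype.sum_bool] at this
    linarith
  unfold Hent push
  simp only [Fintype.sum_bool, BSCk, h, Hb, bconv]
  simp only [if_true, reduceCtorEq, if_false, Bool.true_eq_false, Bool.false_eq_true]
  have e1 : g true * (1 - p) + (1 - g true) * p = bconv (g true) p := rfl
  have e2 : g true * p + (1 - g true) * (1 - p) = 1 - bconv (g true) p := by unfold bconv; ring
  rw [e1, e2]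
  ring

lemma mul_logb_mul (a b : ℝ) :
    a * b * Real.logb 2 (a * b) = a * b * Real.logb 2 a + a * b * Real.logb 2 b := by
  rcases eq_or_ne a 0 with rfl | ha
  · simp
  rcases eq_or_ne b 0 with rfl | hb
  · simp
  rw [Real.logb_mul ha hb]; ring

lemma Hent_push_BEC {e : ℝ} {g : Bool → ℝ} (hg : IsPMF g) :
    Hent (push g (BECk e)) = Hb e + (1 - e) * Hb (g true) := by
  have h : g false = 1 - g true := by
    have := hg.2
    rw [Fintype.sum_bool] at this
    linarith
  unfold Hent push
  simp only [Fintype.sum_option, Fintype.sum_bool, BECk, h, Hb]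
  simp only [if_true, reduceCtorEq, if_false, Bool.true_eq_false, Bool.false_eq_true, mul_zero,
    add_zero, zero_add, mul_logb_mul]
  have e1 : g true * e + (1 - g true) * e = e := by ring
  rw [e1]
  ring

lemma Hent_BSC (p : ℝ) (x : Bool) : Hent (BSCk p x) = Hb p := by
  cases x <;> simp [Hent, BSCk, Hb] <;> ring

lemma Hent_BEC (p : ℝ) (x : Bool) : Hent (BECk p x) = Hb p := by
  cases x <;> simp [Hent, BECk, Hb, Fintype.sum_option] <;> ring

lemma Hb_half : Hb (1/2) = 1 := by
  rw [show Hb (1/2) = -(1/2 * Real.logb 2 (1/2)) - (1/2) * Real.logb 2 (1/2) by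
    unfold Hb; norm_num]
  rw [one_div, Real.logb_inv, Real.logb_self_eq_one (by norm_num)]
  norm_num

lemma qU_push {A Y : Type} [Fintype A] (V : A → Y → ℝ) :
    qU V = push (fun _ => ((Fintype.card A : ℕ) : ℝ)⁻¹) V := by
  funext y
  unfold qU push avg
  rw [mul_sum]

lemma unifB : IsPMF (fun _ : Bool => ((Fintype.card Bool : ℕ) : ℝ)⁻¹) := by
  refine ⟨fun _ => by positivity, ?_⟩
  simp

lemma Hent_qU_BSC (p : ℝ) : Hent (qU (BSCk p)) = 1 := by
  rw [qU_push, Hent_push_BSC unifB, ← Hb_half]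
  congr 1
  simp [bconv]
  ring

lemma Hent_qU_BEC (e : ℝ) : Hent (qU (BECk e)) = Hb e + (1 - e) := by
  rw [qU_push, Hent_push_BEC unifB]
  have : Hb (((Fintype.card Bool : ℕ) : ℝ)⁻¹) = 1 := by
    rw [← Hb_half]; congr 1; simp
  rw [this, mul_one]

lemma Iu_BSC (p : ℝ) : Iu (BSCk p) = 1 - Hb p := by
  unfold Iu
  simp only [Hent_qU_BSC, Hent_BSC, avg_const]

lemma Iu_BEC (e : ℝ) : Iu (BECk e) = 1 - e := by
  unfold Iu
  simp only [Hent_qU_BEC, Hent_BEC, avg_const]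
  ring

lemma pmf_true {g : Bool → ℝ} (hg : IsPMF g) : 0 ≤ g true ∧ g true ≤ 1 := by
  have h := hg.2
  rw [Fintype.sum_bool] at h
  exact ⟨hg.1 _, by linarith [hg.1 false]⟩

lemma gapA {p e : ℝ} (hp0 : 0 ≤ p) (hp1 : p ≤ 1) (he0 : 0 ≤ e) (he1 : e ≤ 1) (h : e ≤ Hb p) :
    EntGap (BSCk p) (BECk e) (Hb e - Hb p) := by
  refine EntGap_of_pmf (BSC_channel hp0 hp1) (BEC_channel he0 he1) fun g hg => ?_
  obtain ⟨a, b⟩ := pmf_true hg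
  rw [Hent_push_BSC hg, Hent_push_BEC hg]
  have h1 := Hb_bconv hp0 hp1 a b
  have h2 := Hb_nonneg a b
  have h3 := Hb_le_one (g true)
  nlinarith

lemma gapB {p e : ℝ} (hp0 : 0 ≤ p) (hp1 : p ≤ 1) (he0 : 0 ≤ e) (he1 : e ≤ 1) (h : Hb p ≤ e) :
    EntGap (BSCk p) (BECk e) (Hb e - e) := by
  refine EntGap_of_pmf (BSC_channel hp0 hp1) (BEC_channel he0 he1) fun g hg => ?_
  obtain ⟨a, b⟩ := pmf_true hg
  rw [Hent_push_BSC hg, Hent_push_BEC hg]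
  have h1 := Hb_bconv hp0 hp1 a b
  have h2 := Hb_nonneg a b
  have h3 := Hb_le_one (g true)
  nlinarith

/-- the channel with a single output -/
def trivK : Bool → Unit → ℝ := fun _ _ => 1

lemma triv_channel : IsChannel trivK := fun _ => ⟨fun _ => zero_le_one, by simp [trivK]⟩

lemma Hent_push_triv {g : Bool → ℝ} (hg : IsPMF g) : Hent (push g trivK) = 0 := by
  have h := hg.2
  rw [Fintype.sum_bool] at h
  simp [Hent, push, trivK, h]

lemma gapT1 {p : ℝ} (hp0 : 0 ≤ p) (hp1 : p ≤ 1) : EntGap (BSCk p) trivK (-1) := by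
  refine EntGap_of_pmf (BSC_channel hp0 hp1) triv_channel fun g hg => ?_
  rw [Hent_push_BSC hg, Hent_push_triv hg]
  linarith [Hb_le_one (bconv (g true) p)]

lemma gapT2 {e : ℝ} (he0 : 0 ≤ e) (he1 : e ≤ 1) : EntGap (BECk e) trivK (-(Hb e + (1 - e))) := by
  refine EntGap_of_pmf (BEC_channel he0 he1) triv_channel fun g hg => ?_
  rw [Hent_push_BEC hg, Hent_push_triv hg]
  nlinarith [Hb_le_one (g true)]

lemma Hent_trivn {A : Type} [Fintype A] [Nonempty A] (n : ℕ) (f : A → Fin n → Bool) :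
    Hent (qU fun a => nF trivK (f a)) = 0 := by
  have : (qU fun a => nF trivK (f a)) = fun _ => 1 := by
    funext y
    simp [qU, nF, trivK, avg_const]
  rw [this]
  simp [Hent]

lemma bound1 {A : Type} [Fintype A] [Nonempty A] {p : ℝ} (hp0 : 0 ≤ p) (hp1 : p ≤ 1) (n : ℕ)
    (f : A → Fin n → Bool) : Hent (qU fun a => nF (BSCk p) (f a)) ≤ n := by
  have := gap_avg (EntGap.nfold (BSC_channel hp0 hp1) triv_channel (gapT1 hp0 hp1) n) f
  rw [Hent_trivn] at this
  linarith

lemma bound2 {A : Type} [Fintype A] [Nonempty A] {e : ℝ} (he0 : 0 ≤ e) (he1 : e ≤ 1) (n : ℕ)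
    (f : A → Fin n → Bool) : Hent (qU fun a => nF (BECk e) (f a)) ≤ n * (Hb e + (1 - e)) := by
  have := gap_avg (EntGap.nfold (BEC_channel he0 he1) triv_channel (gapT2 he0 he1) n) f
  rw [Hent_trivn] at this
  linarith

lemma Hent_nF_const {X Y : Type} [Fintype Y] {W : X → Y → ℝ} (hW : IsChannel W) {h : ℝ}
    (hh : ∀ x, Hent (W x) = h) (n : ℕ) (x : Fin n → X) : Hent (nF W x) = n * h := by
  have := Hent_pi n (fun t => W (x t)) (fun t => (hW _).2)
  unfold nF
  rw [this]
  simp [hh]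

/-- Converse bounds extracted from a code. -/
lemma converse {p e : ℝ} (hp0 : 0 ≤ p) (hp1 : p ≤ 1) (he0 : 0 ≤ e) (he1 : e ≤ 1)
    {W : Bool → Bool × Option Bool → ℝ} (hW : IsChannel W)
    (hm1 : margW1 W = BSCk p) (hm2 : margW2 W = BECk e)
    {n k1 k2 : ℕ} [Nonempty (Fin k1)] [Nonempty (Fin k2)] {f : Fin k1 × Fin k2 → Fin n → Bool}
    {g1 : (Fin n → Bool) × Fin k2 → Fin k1} {g2 : (Fin n → Option Bool) → Fin k2} {l : ℝ}
    (hl0 : 0 < l) (hl1 : l < 1) (herr : errP1 W n k1 k2 f g1 g2 ≤ l) :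
    (1 - l) * Real.logb 2 k1 - fanoD l
      ≤ avg (fun j => Hent (qU fun i => nF (BSCk p) (f (i, j)))) - n * Hb p ∧
    (1 - l) * Real.logb 2 k2 - fanoD l
      ≤ Hent (qU fun m => nF (BECk e) (f m))
        - avg (fun j => Hent (qU fun i => nF (BECk e) (f (i, j)))) := by
  constructor
  · have h1 := (errP1_ge1 hW n k1 k2 f g1 g2).trans herr
    rw [hm1] at h1
    have := fanoU (V := fun i j => nF (BSCk p) (f (i, j)))
      (fun i j => nF_channel (BSC_channel hp0 hp1) _) g1 hl0 hl1 h1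
    simp only [Hent_nF_const (BSC_channel hp0 hp1) (Hent_BSC p), avg_const,
      Fintype.card_fin] at this
    exact this
  · have h1 := (errP1_ge2 hW n k1 k2 f g1 g2).trans herr
    rw [hm2] at h1
    have := fanoU (A := Fin k2) (B := Unit)
      (V := fun j _ => qU (fun i => nF (BECk e) (f (i, j))))
      (fun j _ => qU_channel (fun i => nF_channel (BEC_channel he0 he1) _)) (fun z => g2 z.1)
      hl0 hl1 (by
        refine le_trans (le_of_eq ?_) h1
        rw [avg_prod, avg_prod, avg_comm (A := Fin k1)]
        congr 1
        funext j
        change avg (fun _ : Unit => ∑ y, qU (fun i => nF (BECk e) (f (i, j))) y *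
          (if g2 y = j then 0 else 1)) = avg (fun i : Fin k1 => ∑ y, nF (BECk e) (f (i, j)) y *
          (if g2 y = j then 0 else 1))
        rw [avg_const, avg_sum]
        refine sum_congr rfl fun y _ => ?_
        unfold qU
        rw [avg_mul_right])
    simp only [avg_const, avg_prod (A := Fin k2) (B := Unit), Fintype.card_fin] at this
    have e : (qU fun m => nF (BECk e) (f m))
        = qU fun j => qU (fun i => nF (BECk e) (f (i, j))) := by
      funext y
      unfold qU
      rw [avg_prod, avg_comm]
    rw [e]
    exact this


section Sym
variable {Y A B : Type} [Fintype Y] [Fintype A] [Fintype B] [Nonempty A] [Nonempty B]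

/-- symmetrized encoder -/
def symF {n : ℕ} (f : A × B → Fin n → Bool) : A → B × (Fin n → Bool) → Fin n → Bool :=
  fun v u t => xor (f (v, u.1) t) (u.2 t)

lemma sym_avg {W : Bool → Y → ℝ} {σ : Bool → Y ≃ Y}
    (hσ : ∀ a s y, W (xor a s) y = W a (σ s y)) {n : ℕ} (f : A × B → Fin n → Bool) :
    avg (fun u => Hent (qU fun v => nF W (symF f v u)))
      = avg (fun j => Hent (qU fun i => nF W (f (i, j)))) := by
  rw [avg_prod]
  congr 1
  funext j
  have : ∀ s : Fin n → Bool, Hent (qU fun v => nF W (symF f v (j, s)))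
      = Hent (qU fun i => nF W (f (i, j))) := by
    intro s
    rw [← Hent_equiv (Equiv.piCongrRight fun t => σ (s t)) (qU fun i => nF W (f (i, j)))]
    congr 1
    funext y
    unfold qU nF symF
    simp only [hσ]
    rfl
  simp only [this, avg_const]

/-- xor with a fixed bit -/
def xorE (a : Bool) : Bool ≃ Bool := ⟨fun s => xor a s, fun s => xor a s,
  fun s => by simp, fun s => by simp⟩

lemma sym_qU {W : Bool → Y → ℝ} (hW : IsChannel W) {n : ℕ} (f : A × B → Fin n → Bool) :
    Hent (qU (chU (fun v u => nF W (symF f v u)))) = n * Hent (qU W) := by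
  have h0 : ∀ (x : Fin n → Bool) y,
      avg (fun s : Fin n → Bool => nF W (fun t => xor (x t) (s t)) y) = qU (nF W) y := by
    intro x y
    exact avg_equiv (Equiv.piCongrRight fun t => xorE (x t)) (fun s => nF W s y)
  have h1 : qU (chU (fun v u => nF W (symF f v u))) = fun y => ∏ t, qU W (y t) := by
    funext y
    rw [← qU_nF]
    unfold qU chU symF
    rw [avg_comm]
    have : ∀ v : A, avg (fun u : B × (Fin n → Bool) =>
        nF W (fun t => xor (f (v, u.1) t) (u.2 t)) y) = qU (nF W) y := by
      intro v
      rw [avg_prod]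
      simp only [h0, avg_const]
    simp only [this, avg_const]
    rfl
  rw [h1, Hent_pi n (fun _ => qU W) (fun _ => (qU_channel hW).2)]
  simp

lemma sym_chU {W : Bool → Y → ℝ} (hW : IsChannel W) {σ : Bool → Y ≃ Y}
    (hσ : ∀ a s y, W (xor a s) y = W a (σ s y)) {n : ℕ} (f : A × B → Fin n → Bool) :
    Iu (chU (fun v u => nF W (symF f v u))) = n * Hent (qU W)
      - avg (fun j => Hent (qU fun i => nF W (f (i, j)))) := by
  unfold Iu
  rw [sym_qU hW, ← sym_avg hσ]
  rfl

lemma sym_chV {W : Bool → Y → ℝ} (hW : IsChannel W) {h : ℝ} (hh : ∀ x, Hent (W x) = h)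
    {σ : Bool → Y ≃ Y}
    (hσ : ∀ a s y, W (xor a s) y = W a (σ s y)) {n : ℕ} (f : A × B → Fin n → Bool) :
    Iu (chV (fun v u => nF W (symF f v u)))
      = avg (fun j => Hent (qU fun i => nF W (f (i, j)))) - n * h := by
  rw [Iu_chV (fun v u => nF_channel hW _), sym_avg hσ]
  simp only [Hent_nF_const hW hh, avg_const]

end Sym

lemma BSC_sym (p : ℝ) (a s y : Bool) : BSCk p (xor a s) y = BSCk p a (xorE s y) := by
  cases a <;> cases s <;> cases y <;> simp [BSCk, xorE]

lemma BEC_sym (p : ℝ) (a s : Bool) (y : Option Bool) :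
    BECk p (xor a s) y = BECk p a ((Equiv.optionCongr (xorE s)) y) := by
  rcases y with _ | y
  · rfl
  · cases a <;> cases s <;> cases y <;> simp [BECk, xorE]

lemma ach0_ach1 {X Y1 Y2 : Type} [Fintype Y1] [Fintype Y2] {W : X → Y1 × Y2 → ℝ} {R : ℝ × ℝ}
    (h : Ach0 W R) : Ach1 W R := by
  obtain ⟨h1, h2, h3⟩ := h
  refine ⟨h1, h2, fun ε hε => ?_⟩
  obtain ⟨n, k1, k2, hn, hk1, hk2, f, g1, g2, a, b, c⟩ := h3 ε hε
  exact ⟨n, k1, k2, hn, hk1, hk2, f, fun z => g1 z.1, g2, a, b, c⟩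

/-- choice of a small error level -/
lemma choose_l (R1 R2 : ℝ) {η : ℝ} (hη : 0 < η) :
    ∃ l : ℝ, 0 < l ∧ l < 1 ∧ l * R1 + fanoD l < η ∧ l * R2 + fanoD l < η := by
  have h : ∀ R : ℝ, Filter.Tendsto (fun l => l * R + fanoD l) (nhdsWithin 0 (Set.Ioi 0))
      (nhds 0) := by
    intro R
    have h1 : Filter.Tendsto (fun l : ℝ => l * R) (nhdsWithin 0 (Set.Ioi 0)) (nhds (0 * R)) :=
      ((continuous_id.mul continuous_const).tendsto 0).mono_left nhdsWithin_le_nhds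
    have := h1.add fanoD_tendsto
    simpa using this
  have hs : ∀ᶠ l in nhdsWithin (0:ℝ) (Set.Ioi 0), 0 < l := self_mem_nhdsWithin
  have hs1 : ∀ᶠ l in nhdsWithin (0:ℝ) (Set.Ioi 0), l < 1 :=
    (eventually_lt_nhds (by norm_num)).filter_mono nhdsWithin_le_nhds
  obtain ⟨l, ⟨a, b⟩, c, d⟩ := ((hs.and hs1).and
    (((h R1).eventually_lt_const hη).and ((h R2).eventually_lt_const hη))).exists
  exact ⟨l, a, b, c, d⟩

/-- Rate bounds for an achievable pair, in terms of a concrete code. -/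
lemma ach1_code {p e : ℝ} (hp0 : 0 ≤ p) (hp1 : p ≤ 1) (he0 : 0 ≤ e) (he1 : e ≤ 1)
    {W : Bool → Bool × Option Bool → ℝ} (hW : IsChannel W)
    (hm1 : margW1 W = BSCk p) (hm2 : margW2 W = BECk e) {R : ℝ × ℝ} (hR : Ach1 W R) {η : ℝ}
    (hη : 0 < η) :
    ∃ (n k1 k2 : ℕ) (f : Fin k1 × Fin k2 → Fin n → Bool), 0 < n ∧ 0 < k1 ∧ 0 < k2 ∧
      n * (R.1 - η) < avg (fun j => Hent (qU fun i => nF (BSCk p) (f (i, j)))) - n * Hb p ∧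
      n * (R.2 - η) < Hent (qU fun m => nF (BECk e) (f m))
        - avg (fun j => Hent (qU fun i => nF (BECk e) (f (i, j)))) := by
  obtain ⟨l, hl0, hl1, a1, a2⟩ := choose_l R.1 R.2 hη
  obtain ⟨h1, h2, h3⟩ := hR
  obtain ⟨n, k1, k2, hn, hk1, hk2, f, g1, g2, a, b, c⟩ := h3 l hl0
  have : Nonempty (Fin k1) := ⟨⟨0, hk1⟩⟩
  have : Nonempty (Fin k2) := ⟨⟨0, hk2⟩⟩
  obtain ⟨c1, c2⟩ := converse hp0 hp1 he0 he1 hW hm1 hm2 hl0 hl1 c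
  have hnr : (1:ℝ) ≤ n := by exact_mod_cast hn
  have hf := fanoD_nonneg hl0 hl1
  have key : ∀ R L : ℝ, l * R + fanoD l < η → R ≤ L / n →
      n * (R - η) < (1 - l) * L - fanoD l := by
    intro R L hh hRL
    rw [le_div_iff₀ (by linarith)] at hRL
    have : (1 - l) * (R * n) ≤ (1 - l) * L := mul_le_mul_of_nonneg_left hRL (by linarith)
    have t1 : n * (l * R + fanoD l) < n * η := mul_lt_mul_of_pos_left hh (by linarith)
    nlinarith
  refine ⟨n, k1, k2, f, hn, hk1, hk2, ?_, ?_⟩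
  · exact (key _ _ a1 a).trans_le c1
  · exact (key _ _ a2 b).trans_le c2

lemma partII {p e : ℝ} (hp0 : 0 ≤ p) (hp1 : p ≤ 1) (he0 : 0 ≤ e) (he1 : e ≤ 1)
    {W : Bool → Bool × Option Bool → ℝ} (hW : IsChannel W)
    (hm1 : margW1 W = BSCk p) (hm2 : margW2 W = BECk e) (h : Hb p ≤ e) : Cap1 W = Cap W := by
  unfold Cap1 Cap
  refine Set.Subset.antisymm (closure_minimal ?_ isClosed_closure)
    (closure_mono fun R hR => ach0_ach1 hR)
  intro R hR
  have hR' : Ach1 W R := hR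
  have main : ∀ η : ℝ, 0 < η → Ach0 W (max 0 (R.1 - η), max 0 (R.2 - η)) := by
    intro η hη
    obtain ⟨n, k1, k2, f, hn, hk1, hk2, c1, c2⟩ :=
      ach1_code hp0 hp1 he0 he1 hW hm1 hm2 hR' hη
    have : Nonempty (Fin k1) := ⟨⟨0, hk1⟩⟩
    have : Nonempty (Fin k2) := ⟨⟨0, hk2⟩⟩
    have B := BSC_channel hp0 hp1
    have E := BEC_channel he0 he1
    have b2 := bound2 he0 he1 n f
    have gp : avg (fun j => Hent (qU fun i => nF (BSCk p) (f (i, j)))) + n * (Hb e - e)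
        ≤ avg (fun j => Hent (qU fun i => nF (BECk e) (f (i, j)))) := by
      rw [← avg_const (B := Fin k2) (n * (Hb e - e)), ← avg_add]
      refine avg_mono fun j => ?_
      have := gap_avg (EntGap.nfold B E (gapB hp0 hp1 he0 he1 h) n) (fun i => f (i, j))
      linarith
    have mx : ∀ r I : ℝ, n * r < I → max 0 r = 0 ∨ n * max 0 r < I := by
      intro r I hrI
      rcases le_total r 0 with h0 | h0
      · left; exact max_eq_left h0
      · right; rw [max_eq_right h0]; exact hrI
    refine achB hW hn (symF f) (le_max_left _ _) (le_max_left _ _) (mx _ _ ?_) (mx _ _ ?_)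
      (mx _ _ ?_)
    · rw [hm1, sym_chV B (Hent_BSC p) (BSC_sym p)]
      exact c1
    · rw [hm2, sym_chU E (BEC_sym e), Hent_qU_BEC]
      linarith
    · rw [hm1, sym_chU B (BSC_sym p), Hent_qU_BSC]
      linarith
  have ht : Filter.Tendsto (fun η : ℝ => (max 0 (R.1 - η), max 0 (R.2 - η)))
      (nhdsWithin 0 (Set.Ioi 0)) (nhds R) := by
    have hc : Continuous (fun η : ℝ => (max 0 (R.1 - η), max 0 (R.2 - η))) := by fun_prop
    have := (hc.tendsto 0).mono_left (nhdsWithin_le_nhds (s := Set.Ioi 0))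
    simpa [max_eq_right hR'.1, max_eq_right hR'.2.1] using this
  refine mem_closure_of_tendsto ht ?_
  filter_upwards [self_mem_nhdsWithin] with η hη
  exact main η hη

lemma partI {p e : ℝ} (hp0 : 0 ≤ p) (hp1 : p ≤ 1) (he0 : 0 ≤ e) (he1 : e ≤ 1)
    {W : Bool → Bool × Option Bool → ℝ} (hW : IsChannel W)
    (hm1 : margW1 W = BSCk p) (hm2 : margW2 W = BECk e) (h : e ≤ Hb p) :
    Cap1 W = {R : ℝ × ℝ | 0 ≤ R.1 ∧ 0 ≤ R.2 ∧ R.1 ≤ 1 - Hb p ∧ R.1 + R.2 ≤ 1 - e} := by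
  unfold Cap1
  have hHb := Hb_le_one p
  refine Set.Subset.antisymm (closure_minimal ?_ ?_) ?_
  · intro R hR
    have hR' : Ach1 W R := hR
    have main : ∀ η : ℝ, 0 < η → R.1 ≤ 1 - Hb p + η ∧ R.1 + R.2 ≤ 1 - e + 2 * η := by
      intro η hη
      obtain ⟨n, k1, k2, f, hn, hk1, hk2, c1, c2⟩ :=
        ach1_code hp0 hp1 he0 he1 hW hm1 hm2 hR' hη
      have : Nonempty (Fin k1) := ⟨⟨0, hk1⟩⟩
      have : Nonempty (Fin k2) := ⟨⟨0, hk2⟩⟩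
      have hnr : (0:ℝ) < n := by exact_mod_cast hn
      have B := BSC_channel hp0 hp1
      have E := BEC_channel he0 he1
      have b2 := bound2 he0 he1 n f
      have b1 : avg (fun j => Hent (qU fun i => nF (BSCk p) (f (i, j)))) ≤ n := by
        rw [← avg_const (B := Fin k2) (n:ℝ)]
        exact avg_mono fun j => bound1 hp0 hp1 n (fun i => f (i, j))
      have gp : avg (fun j => Hent (qU fun i => nF (BSCk p) (f (i, j)))) + n * (Hb e - Hb p)
          ≤ avg (fun j => Hent (qU fun i => nF (BECk e) (f (i, j)))) := by
        rw [← avg_const (B := Fin k2) (n * (Hb e - Hb p)), ← avg_add]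
        refine avg_mono fun j => ?_
        have := gap_avg (EntGap.nfold B E (gapA hp0 hp1 he0 he1 h) n) (fun i => f (i, j))
        linarith
      constructor
      · have : n * (R.1 - η) ≤ n * (1 - Hb p) := by linarith
        have := le_of_mul_le_mul_left this hnr
        linarith
      · have : n * (R.1 - η + (R.2 - η)) ≤ n * (1 - e) := by linarith
        have := le_of_mul_le_mul_left this hnr
        linarith
    refine ⟨hR'.1, hR'.2.1, le_of_forall_pos_le_add fun η hη => (main η hη).1,
      le_of_forall_pos_le_add fun η hη => ?_⟩
    have := (main (η / 2) (by linarith)).2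
    linarith
  · refine IsClosed.inter (isClosed_le continuous_const continuous_fst)
      (IsClosed.inter (isClosed_le continuous_const continuous_snd)
      (IsClosed.inter (isClosed_le continuous_fst continuous_const)
      (isClosed_le (continuous_fst.add continuous_snd) continuous_const)))
  · rintro R ⟨r1, r2, r3, r4⟩
    have ht : Filter.Tendsto (fun η : ℝ => ((1 - η) * R.1, (1 - η) * R.2))
        (nhdsWithin 0 (Set.Ioi 0)) (nhds R) := by
      have hc : Continuous (fun η : ℝ => ((1 - η) * R.1, (1 - η) * R.2)) := by fun_prop
      have := (hc.tendsto 0).mono_left (nhdsWithin_le_nhds (s := Set.Ioi 0))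
      simpa using this
    refine mem_closure_of_tendsto ht ?_
    have hs1 : ∀ᶠ l in nhdsWithin (0:ℝ) (Set.Ioi 0), l < 1 :=
      (eventually_lt_nhds (by norm_num)).filter_mono nhdsWithin_le_nhds
    filter_upwards [self_mem_nhdsWithin, hs1] with η hη hη1
    have hη0 : 0 < η := hη
    refine achA hW (mul_nonneg (by linarith) r1) (mul_nonneg (by linarith) r2) ?_ ?_
    · rw [hm1, Iu_BSC]
      rcases r1.eq_or_lt with z | z
      · left; rw [← z, mul_zero]
      · right; nlinarith
    · rw [hm2, Iu_BEC]
      rcases (add_nonneg r1 r2).eq_or_lt with z | z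
      · left
        have z1 : R.1 = 0 := by linarith
        have z2 : R.2 = 0 := by linarith
        rw [z1, z2, mul_zero]; exact ⟨rfl, rfl⟩
      · right; nlinarith


/-- **Proposition 6.** Explicit characterization of `𝒞₁(BSC(p)&BEC(ε))`. -/
theorem bscbec_cap1
    (p e : ℝ) (hp0 : 0 ≤ p) (hp : p ≤ 1/2) (he0 : 0 ≤ e) (he : e ≤ 1)
    (W : Bool → Bool × Option Bool → ℝ) (hW : IsChannel W)
    (hm1 : ∀ x y, margW1 W x y = BSCk p x y)
    (hm2 : ∀ x y, margW2 W x y = BECk e x y) :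
    (e ≤ Hb p →
      Cap1 W = {R : ℝ × ℝ | 0 ≤ R.1 ∧ 0 ≤ R.2 ∧
        R.1 ≤ 1 - Hb p ∧ R.1 + R.2 ≤ 1 - e}) ∧
    (Hb p < e → Cap1 W = Cap W) := by
  have e1 : margW1 W = BSCk p := funext fun x => funext fun y => hm1 x y
  have e2 : margW2 W = BECk e := funext fun x => funext fun y => hm2 x y
  have hp1 : p ≤ 1 := by linarith
  exact ⟨fun h => partI hp0 hp1 he0 he hW e1 e2 h, fun h => partII hp0 hp1 he0 he hW e1 e2 h.le⟩

end
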